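/- Let k ≥ 3 and h ≥ 4 be integers, set a := 3^{h−1}, n := 3^k + 3^h and N := 3^k + 2a, and let C_h := B_{3^h}(2a) ∖ {(2a, a−1, 1), (2a, 2, 1^{a−2}), (2a−1, a+1), (2a−1, 1^{a+1})}°. Then ( P(3^k) ∖ {(3^k−1, 1), (2, 1^{3^k−2})} ) ⋆ C_h = B_n(N−1) ∪ {(N, μ) : μ ∈ P(a) ∖ {(a−1, 1), (2, 1^{a−2})}}°, where (N, μ) denotes the partition of n with first part N followed by the parts of μ. -/

import Mathlib

open scoped Classical

namespace SylowBranching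

/-- The cells of the Young diagram of `f` (rows indexed by the first coordinate,
starting from `0`; `f i` is the length of row `i`). -/
def cellsOf (f : ℕ → ℕ) : Set (ℕ × ℕ) := {p | p.2 < f p.1}

/-- `f : ℕ → ℕ` is a partition if it is weakly decreasing with finitely many
nonzero parts.  Its parts are `f 0 ≥ f 1 ≥ ⋯`, and its largest part is `f 0`. -/
def IsPartition (f : ℕ → ℕ) : Prop :=
  Antitone f ∧ ∃ N, ∀ i, N ≤ i → f i = 0

/-- The size `|f|` of a partition: the number of cells of its Young diagram. -/
noncomputable def psize (f : ℕ → ℕ) : ℕ := (cellsOf f).ncard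

/-- `P(n)`: the set of partitions of `n`. -/
def Pset (n : ℕ) : Set (ℕ → ℕ) := {f | IsPartition f ∧ psize f = n}

/-- The conjugate (transpose) partition `f'`. -/
noncomputable def conj (f : ℕ → ℕ) : ℕ → ℕ := fun j => Set.ncard {i | j < f i}

/-- `A° = A ∪ A'`: the closure of a set of partitions under conjugation. -/
noncomputable def conjClosure (A : Set (ℕ → ℕ)) : Set (ℕ → ℕ) := A ∪ conj '' A

/-- `B_n(t)`: partitions of `n` with largest part at most `t` and at most `t` parts. -/
noncomputable def Bset (n t : ℕ) : Set (ℕ → ℕ) :=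
  {f ∈ Pset n | f 0 ≤ t ∧ conj f 0 ≤ t}

/-- The cells of the skew shape `l / m`. -/
def skewCells (l m : ℕ → ℕ) : Set (ℕ × ℕ) :=
  {p | m p.1 ≤ p.2 ∧ p.2 < l p.1}

/-- `d` is read before (or at the same time as) `c` in the reading order of a
filling: right-to-left along rows, rows from top to bottom. -/
def readBefore (d c : ℕ × ℕ) : Prop :=
  d.1 < c.1 ∨ (d.1 = c.1 ∧ c.2 ≤ d.2)

/-- A Littlewood–Richardson filling of the cell set `γ` of weight `ν`:
all entries are positive; for every `j ≥ 1` there are exactly `ν (j-1)` entries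
equal to `j` (i.e. the number of `j`s is the `j`-th part of `ν`); entries weakly
increase along rows and strictly increase down columns; and every initial
segment of the reading word (right-to-left along rows, top to bottom) contains
at least as many entries equal to `j` as entries equal to `j+1`, for all `j ≥ 1`. -/
structure IsLRFilling (γ : Set (ℕ × ℕ)) (ν : ℕ → ℕ) (T : ℕ × ℕ → ℕ) : Prop where
  pos : ∀ c ∈ γ, 1 ≤ T c
  weight : ∀ j : ℕ, 1 ≤ j → Set.ncard {c ∈ γ | T c = j} = ν (j - 1)
  row_weak : ∀ i j j', (i, j) ∈ γ → (i, j') ∈ γ → j ≤ j' → T (i, j) ≤ T (i, j')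
  col_strict : ∀ i i' j, (i, j) ∈ γ → (i', j) ∈ γ → i < i' → T (i, j) < T (i', j)
  lattice : ∀ c ∈ γ, ∀ j : ℕ, 1 ≤ j →
    Set.ncard {d ∈ γ | T d = j + 1 ∧ readBefore d c} ≤
      Set.ncard {d ∈ γ | T d = j ∧ readBefore d c}

/-- `LR(γ)`: the set of all weights of LR fillings of `γ`. -/
def LRset (γ : Set (ℕ × ℕ)) : Set (ℕ → ℕ) := {ν | ∃ T, IsLRFilling γ ν T}

/-- The Littlewood–Richardson coefficient `c^l_{m ν}`: the number of LR fillings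
of the skew shape `l / m` of weight `ν` (zero unless `m ⊆ l`); fillings are
normalised to vanish off the skew shape so that they can be counted. -/
noncomputable def LRcoeff (l m ν : ℕ → ℕ) : ℕ :=
  Set.ncard {T : ℕ × ℕ → ℕ |
    (∀ i, m i ≤ l i) ∧ (∀ c, c ∉ skewCells l m → T c = 0) ∧
      IsLRFilling (skewCells l m) ν T}

/-- The `⋆` operation on sets of partitions:
`A ⋆ B = {λ : c^λ_{μν} > 0 for some μ ∈ A, ν ∈ B}`. -/
def starOp (A B : Set (ℕ → ℕ)) : Set (ℕ → ℕ) :=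
  {l | IsPartition l ∧ ∃ μ ∈ A, ∃ ν ∈ B, 0 < LRcoeff l μ ν}

/-- The partition with the given (weakly decreasing) list of parts. -/
def ofList (L : List ℕ) : ℕ → ℕ := fun i => L.getD i 0

/-- The hook partition `(a, 1^b)`. -/
def hookP (a b : ℕ) : ℕ → ℕ := ofList (a :: List.replicate b 1)

/-- The partition `(a, μ)` obtained by prepending a first part `a` to `μ`. -/
def consPart (a : ℕ) (μ : ℕ → ℕ) : ℕ → ℕ := fun i => if i = 0 then a else μ (i - 1)

/-- `γ` coincides, up to planar translation, with the Young diagram of `ν`. -/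
def TranslateOf (γ : Set (ℕ × ℕ)) (ν : ℕ → ℕ) : Prop :=
  ∃ a b : ℕ, γ = (fun p : ℕ × ℕ => (p.1 + a, p.2 + b)) '' cellsOf ν

/-- `γ` coincides, up to planar translation, with the 180°-rotation of the
Young diagram of `ν`. -/
def RotationOf (γ : Set (ℕ × ℕ)) (ν : ℕ → ℕ) : Prop :=
  ∃ a b : ℕ, (∀ p ∈ cellsOf ν, p.1 ≤ a ∧ p.2 ≤ b) ∧
    γ = (fun p : ℕ × ℕ => (a - p.1, b - p.2)) '' cellsOf ν

/-- Iterated Littlewood–Richardson coefficients `c^l_{μ^1, …, μ^r}`: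
`c^l_{μ} = δ_{l μ}`, and the coefficient for a longer list is obtained by
summing, over partitions `g` of the total size of the remaining factors, the
product of the iterated coefficient of `g` with `c^l_{g μ}`. -/
noncomputable def iterLR : List (ℕ → ℕ) → (ℕ → ℕ) → ℕ
  | [], l => if l = (fun _ => 0 : ℕ → ℕ) then 1 else 0
  | [μ], l => if l = μ then 1 else 0
  | μ :: μs, l =>
      ∑' g : {g : ℕ → ℕ // IsPartition g ∧ psize g = (μs.map psize).sum},
        iterLR μs g.1 * LRcoeff l g.1 μ

/-- `D(q, m, B)`: partitions `λ` of `qm` with `c^λ_{μ_1, …, μ_q} > 0` for some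
`μ_1, …, μ_q ∈ B` that are not all equal. -/
noncomputable def Dset (q m : ℕ) (B : Set (ℕ → ℕ)) : Set (ℕ → ℕ) :=
  {l ∈ Pset (q * m) | ∃ μ : Fin q → (ℕ → ℕ),
    (∀ i, μ i ∈ B) ∧ (∃ i j, μ i ≠ μ j) ∧ 0 < iterLR (List.ofFn μ) l}

/-- Iterated `⋆` of a list of sets of partitions. -/
def starAll : List (Set (ℕ → ℕ)) → Set (ℕ → ℕ)
  | [] => Pset 0
  | [A] => A
  | A :: B :: rest => starOp A (starAll (B :: rest))

/-- `Ω(φ(1,0,…,0))` for the Sylow 3-subgroup of `S_{3^k}` (`k ≥ 4`):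
`B_{3^k}(2a) ∖ {(2a, a−1, 1), (2a, 2, 1^{a−2}), (2a−1, a+1), (2a−1, 1^{a+1})}°`
where `a = 3^{k−1}`. -/
noncomputable def Cset (k : ℕ) : Set (ℕ → ℕ) :=
  Bset (3 ^ k) (2 * 3 ^ (k - 1)) \
    conjClosure
      {ofList [2 * 3 ^ (k - 1), 3 ^ (k - 1) - 1, 1],
       ofList (2 * 3 ^ (k - 1) :: 2 :: List.replicate (3 ^ (k - 1) - 2) 1),
       ofList [2 * 3 ^ (k - 1) - 1, 3 ^ (k - 1) + 1],
       hookP (2 * 3 ^ (k - 1) - 1) (3 ^ (k - 1) + 1)}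

/-! ### Partitions, conjugation and sizes -/

lemma exists_bound {f : ℕ → ℕ} (hf : ∃ M, ∀ i, M ≤ i → f i = 0) :
    ∃ M, ∀ i, f i ≤ M := by
  obtain ⟨M, hM⟩ := hf
  refine ⟨∑ i ∈ Finset.range M, f i, fun i => ?_⟩
  rcases lt_or_ge i M with h | h
  · exact Finset.single_le_sum (f := f) (fun _ _ => Nat.zero_le _) (Finset.mem_range.2 h)
  · simp [hM i h]

lemma finite_lt {f : ℕ → ℕ} (hf : ∃ M, ∀ i, M ≤ i → f i = 0) (j : ℕ) :
    {i | j < f i}.Finite := by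
  obtain ⟨M, hM⟩ := hf
  refine (Set.finite_Iio M).subset fun i hi => ?_
  by_contra h
  simp only [Set.mem_Iio, not_lt] at h
  have := hM i h
  simp only [Set.mem_ofPred_eq] at hi
  omega

lemma lt_conj_iff {f : ℕ → ℕ} (hf : IsPartition f) (i j : ℕ) :
    i < conj f j ↔ j < f i := by
  obtain ⟨ha, M, hM⟩ := hf
  have hex : ∃ k, f k ≤ j := ⟨M, by rw [hM M le_rfl]; exact Nat.zero_le _⟩
  have hset : {i | j < f i} = Set.Iio (Nat.find hex) := by
    ext x
    simp only [Set.mem_ofPred_eq, Set.mem_Iio]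
    constructor
    · intro hx
      by_contra hc
      have := ha (not_lt.1 hc)
      have := Nat.find_spec hex
      omega
    · intro hx
      exact not_le.1 (Nat.find_min hex hx)
  have : conj f j = Nat.find hex := by
    unfold conj
    rw [hset, ← Finset.coe_Iio, Set.ncard_coe_finset, Nat.card_Iio]
  rw [this]
  exact (Set.ext_iff.1 hset i).symm

lemma conj_isPartition {d : ℕ → ℕ} (hd : ∃ M, ∀ i, M ≤ i → d i = 0) :
    IsPartition (conj d) := by
  refine ⟨fun j j' hj => ?_, ?_⟩
  · exact Set.ncard_le_ncard (fun i (hi : j' < d i) => lt_of_le_of_lt hj hi) (finite_lt hd j)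
  · obtain ⟨M, hM⟩ := exists_bound hd
    refine ⟨M, fun j hj => ?_⟩
    have : {i | j < d i} = ∅ := by
      ext i
      have := hM i
      simp only [Set.mem_ofPred_eq, Set.mem_empty_iff_false, iff_false]
      omega
    unfold conj
    rw [this, Set.ncard_empty]

lemma IsPartition.conj {f : ℕ → ℕ} (hf : IsPartition f) : IsPartition (conj f) :=
  conj_isPartition hf.2

lemma eq_of_lt_iff {x y : ℕ} (h : ∀ i, i < x ↔ i < y) : x = y := by
  have h1 := h x
  have h2 := h y
  omega

lemma conj_conj {f : ℕ → ℕ} (hf : IsPartition f) : conj (conj f) = f := by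
  funext j
  exact eq_of_lt_iff fun i => by rw [lt_conj_iff hf.conj, lt_conj_iff hf]

lemma conj_injective {f g : ℕ → ℕ} (hf : IsPartition f) (hg : IsPartition g)
    (h : conj f = conj g) : f = g := by
  rw [← conj_conj hf, h, conj_conj hg]

lemma conj_eq_of_iff {f g : ℕ → ℕ} (hf : IsPartition f)
    (h : ∀ i j, j < f i ↔ i < g j) : conj f = g := by
  funext j
  exact eq_of_lt_iff fun i => by rw [lt_conj_iff hf, h]

lemma cellsOf_eq_coe {f : ℕ → ℕ} {M : ℕ} (hM : ∀ i, M ≤ i → f i = 0) :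
    cellsOf f = ((((Finset.range M).sigma fun i => Finset.range (f i)).map
      (Equiv.sigmaEquivProd ℕ ℕ).toEmbedding : Finset (ℕ × ℕ)) : Set (ℕ × ℕ)) := by
  ext ⟨i, j⟩
  simp only [cellsOf, Set.mem_ofPred_eq, Finset.coe_map, Set.mem_image, Finset.mem_coe,
    Finset.mem_sigma, Finset.mem_range, Equiv.coe_toEmbedding, Sigma.exists,
    Equiv.sigmaEquivProd_apply, Prod.mk.injEq]
  constructor
  · intro h
    refine ⟨i, j, ⟨?_, h⟩, rfl, rfl⟩
    by_contra hc
    have := hM i (not_lt.1 hc)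
    omega
  · rintro ⟨i', j', ⟨_, h⟩, rfl, rfl⟩
    exact h

lemma cellsOf_finite {f : ℕ → ℕ} (hf : ∃ M, ∀ i, M ≤ i → f i = 0) : (cellsOf f).Finite := by
  obtain ⟨M, hM⟩ := hf
  rw [cellsOf_eq_coe hM]
  exact Finset.finite_toSet _

lemma psize_eq_sum {f : ℕ → ℕ} {M : ℕ} (hM : ∀ i, M ≤ i → f i = 0) :
    psize f = ∑ i ∈ Finset.range M, f i := by
  unfold psize
  rw [cellsOf_eq_coe hM, Set.ncard_coe_finset, Finset.card_map, Finset.card_sigma]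
  simp

lemma conj_eq_card {d : ℕ → ℕ} {M : ℕ} (hM : ∀ i, M ≤ i → d i = 0) (c : ℕ) :
    conj d c = ((Finset.range M).filter fun i => c < d i).card := by
  unfold conj
  rw [← Set.ncard_coe_finset]
  congr 1
  ext i
  simp only [Set.mem_ofPred_eq, Finset.coe_filter, Finset.mem_range]
  constructor
  · intro h
    refine ⟨?_, h⟩
    by_contra hc
    have := hM i (not_lt.1 hc)
    omega
  · exact fun h => h.2

lemma psize_conj {d : ℕ → ℕ} (hd : ∃ M, ∀ i, M ≤ i → d i = 0) :
    psize (conj d) = psize d := by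
  obtain ⟨K, hK⟩ := exists_bound hd
  obtain ⟨M, hM⟩ := hd
  have hconj : ∀ c, K ≤ c → conj d c = 0 := by
    intro c hc
    rw [conj_eq_card hM, Finset.card_eq_zero, Finset.filter_eq_empty_iff]
    intro i _
    have := hK i
    omega
  rw [psize_eq_sum hM, psize_eq_sum hconj]
  simp_rw [conj_eq_card hM, Finset.card_filter]
  rw [Finset.sum_comm]
  refine Finset.sum_congr rfl fun i _ => ?_
  rw [← Finset.card_filter]
  have : (Finset.range K).filter (fun c => c < d i) = Finset.range (d i) := by
    ext c
    have := hK i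
    simp only [Finset.mem_filter, Finset.mem_range]
    omega
  rw [this, Finset.card_range]

lemma exists_common_bound {f g : ℕ → ℕ} (hf : ∃ M, ∀ i, M ≤ i → f i = 0)
    (hg : ∃ M, ∀ i, M ≤ i → g i = 0) :
    ∃ M, (∀ i, M ≤ i → f i = 0) ∧ ∀ i, M ≤ i → g i = 0 := by
  obtain ⟨M, hM⟩ := hf
  obtain ⟨K, hK⟩ := hg
  exact ⟨max M K, fun i hi => hM i (le_trans (le_max_left _ _) hi),
    fun i hi => hK i (le_trans (le_max_right _ _) hi)⟩

lemma sub_finite {l m : ℕ → ℕ} (hl : ∃ M, ∀ i, M ≤ i → l i = 0) :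
    ∃ M, ∀ i, M ≤ i → (fun i => l i - m i) i = 0 := by
  obtain ⟨M, hM⟩ := hl
  exact ⟨M, fun i hi => by simp [hM i hi]⟩

lemma finite_of_le {l m : ℕ → ℕ} (hl : ∃ M, ∀ i, M ≤ i → l i = 0) (h : ∀ i, m i ≤ l i) :
    ∃ M, ∀ i, M ≤ i → m i = 0 := by
  obtain ⟨M, hM⟩ := hl
  exact ⟨M, fun i hi => by have := hM i hi; have := h i; omega⟩

lemma psize_sub_add {l m : ℕ → ℕ} (hl : ∃ M, ∀ i, M ≤ i → l i = 0) (h : ∀ i, m i ≤ l i) :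
    psize (fun i => l i - m i) + psize m = psize l := by
  obtain ⟨M, h1, h2⟩ := exists_common_bound hl (finite_of_le hl h)
  rw [psize_eq_sum h1, psize_eq_sum h2, psize_eq_sum (f := fun i => l i - m i) (M := M)
    (fun i hi => by simp [h1 i hi]), ← Finset.sum_add_distrib]
  exact Finset.sum_congr rfl fun i _ => Nat.sub_add_cancel (h i)

lemma psize_le_psize {l m : ℕ → ℕ} (hl : ∃ M, ∀ i, M ≤ i → l i = 0) (h : ∀ i, m i ≤ l i) :
    psize m ≤ psize l := by
  have := psize_sub_add hl h
  omega

lemma sum_le_psize {f : ℕ → ℕ} (hf : ∃ M, ∀ i, M ≤ i → f i = 0) (S : Finset ℕ) :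
    ∑ i ∈ S, f i ≤ psize f := by
  obtain ⟨M, hM⟩ := hf
  obtain ⟨K, hK⟩ := S.exists_nat_subset_range
  rw [psize_eq_sum (M := max M K) (fun i hi => hM i (le_trans (le_max_left _ _) hi))]
  exact Finset.sum_le_sum_of_subset
    (hK.trans (Finset.range_subset_range.2 (le_max_right _ _)))

lemma eq_zero_of_conj_zero_le {f : ℕ → ℕ} (hf : IsPartition f) {i : ℕ} (h : conj f 0 ≤ i) :
    f i = 0 := by
  by_contra hc
  have := (lt_conj_iff hf i 0).2 (Nat.pos_of_ne_zero hc)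
  omega

/-- The hook through the corner has at most `psize f` cells. -/
lemma head_add_conj_le {f : ℕ → ℕ} (hf : IsPartition f) (h : 0 < conj f 0) :
    f 0 + conj f 0 ≤ psize f + 1 := by
  rw [psize_eq_sum (fun i hi => eq_zero_of_conj_zero_le hf hi)]
  obtain ⟨r, hr⟩ := Nat.exists_eq_succ_of_ne_zero h.ne'
  rw [hr, Finset.sum_range_succ']
  have : ∑ i ∈ Finset.range r, 1 ≤ ∑ i ∈ Finset.range r, f (i + 1) := by
    refine Finset.sum_le_sum fun i hi => ?_
    have := Finset.mem_range.1 hi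
    exact (lt_conj_iff hf (i + 1) 0).1 (by omega)
  simp at this
  omega

/-! ### Littlewood–Richardson fillings -/

lemma skewCells_finite {l : ℕ → ℕ} (hl : ∃ M, ∀ i, M ≤ i → l i = 0) (m : ℕ → ℕ) :
    (skewCells l m).Finite :=
  (cellsOf_finite hl).subset fun _ hp => hp.2

lemma readBefore_trans {a b c : ℕ × ℕ} (hab : readBefore a b) (hbc : readBefore b c) :
    readBefore a c := by
  unfold readBefore at *
  omega

/-- In a Littlewood–Richardson filling the entries of row `i` (counted from `0`) are at
most `i + 1`. -/
lemma IsLRFilling.le_row {γ : Set (ℕ × ℕ)} {ν : ℕ → ℕ} {T : ℕ × ℕ → ℕ}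
    (hT : IsLRFilling γ ν T) (hγ : γ.Finite) (i : ℕ) :
    ∀ j, (i, j) ∈ γ → T (i, j) ≤ i + 1 := by
  induction i using Nat.strong_induction_on with
  | _ i ih =>
    intro j hc
    by_contra hlt
    obtain ⟨v, hv⟩ : ∃ v, T (i, j) = v + 1 := ⟨T (i, j) - 1, by omega⟩
    have h := hT.lattice (i, j) hc v (by omega)
    have hpos : 0 < Set.ncard {d ∈ γ | T d = v + 1 ∧ readBefore d (i, j)} := by
      rw [Set.ncard_pos (hγ.subset (Set.sep_subset _ _))]
      exact ⟨(i, j), hc, hv, Or.inr ⟨rfl, le_rfl⟩⟩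
    have hpos' := lt_of_lt_of_le hpos h
    rw [Set.ncard_pos (hγ.subset (Set.sep_subset _ _))] at hpos'
    obtain ⟨⟨i', j'⟩, hd, hTd, hr⟩ := hpos'
    rcases hr with hr | ⟨hr, hr'⟩
    · have := ih i' hr j' hd
      simp only at hr
      omega
    · simp only at hr hr'
      subst hr
      have := hT.row_weak i' j j' hc hd hr'
      omega

lemma IsLRFilling.congr {γ : Set (ℕ × ℕ)} {ν : ℕ → ℕ} {T T' : ℕ × ℕ → ℕ}
    (hT : IsLRFilling γ ν T) (h : ∀ c ∈ γ, T' c = T c) : IsLRFilling γ ν T' := by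
  have hset : ∀ (v : ℕ) (p : ℕ × ℕ → Prop),
      {d ∈ γ | T' d = v ∧ p d} = {d ∈ γ | T d = v ∧ p d} := by
    intro v p
    ext d
    simp only [Set.mem_ofPred_eq]
    constructor
    · rintro ⟨h1, h2, h3⟩
      exact ⟨h1, by rw [← h d h1]; exact h2, h3⟩
    · rintro ⟨h1, h2, h3⟩
      exact ⟨h1, by rw [h d h1]; exact h2, h3⟩
  refine ⟨fun c hc => by rw [h c hc]; exact hT.pos c hc, fun j hj => ?_, ?_, ?_, ?_⟩
  · have := hset j fun _ => True
    simp only [and_true] at this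
    rw [this]
    exact hT.weight j hj
  · intro i j j' h1 h2 h3
    rw [h _ h1, h _ h2]
    exact hT.row_weak i j j' h1 h2 h3
  · intro i i' j h1 h2 h3
    rw [h _ h1, h _ h2]
    exact hT.col_strict i i' j h1 h2 h3
  · intro c hc j hj
    rw [hset, hset]
    exact hT.lattice c hc j hj

lemma finite_bounded_functions {γ : Set (ℕ × ℕ)} (hγ : γ.Finite) (M : ℕ) :
    {T : ℕ × ℕ → ℕ | (∀ c, c ∉ γ → T c = 0) ∧ ∀ c ∈ γ, T c ≤ M}.Finite := by
  have := hγ.to_subtype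
  refine Set.Finite.of_finite_image (f := fun T (c : γ) => T c.1) ?_ ?_
  · refine (Set.Finite.pi' (fun _ : γ => Set.finite_Iic M)).subset ?_
    rintro _ ⟨T, hT, rfl⟩ c
    exact hT.2 c.1 c.2
  · intro T hT T' hT' h
    funext c
    by_cases hc : c ∈ γ
    · exact congrFun h ⟨c, hc⟩
    · rw [hT.1 c hc, hT'.1 c hc]

lemma LRcoeff_pos_iff {l m ν : ℕ → ℕ} (hl : IsPartition l) :
    0 < LRcoeff l m ν ↔
      (∀ i, m i ≤ l i) ∧ ∃ T, IsLRFilling (skewCells l m) ν T := by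
  have hγ := skewCells_finite hl.2 m
  obtain ⟨M, hM⟩ := hl.2
  unfold LRcoeff
  rw [Set.ncard_pos ?_]
  · constructor
    · rintro ⟨T, h1, _, h3⟩
      exact ⟨h1, T, h3⟩
    · rintro ⟨h1, T, hT⟩
      refine ⟨fun c => if c ∈ skewCells l m then T c else 0, h1, fun c hc => by simp [hc], ?_⟩
      exact hT.congr fun c hc => by simp [hc]
  · refine (finite_bounded_functions hγ M).subset ?_
    rintro T ⟨_, h2, h3⟩
    refine ⟨h2, ?_⟩
    rintro ⟨i, j⟩ hc
    have := h3.le_row hγ i j hc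
    have hi : i < M := by
      by_contra h
      have := hM i (not_lt.1 h)
      have := hc.2
      simp only at this
      omega
    omega

/-- A filling whose cells carry labels, such that the cells with a given label contain
`1, 2, …, r` in reading order, satisfies the lattice condition. -/
lemma IsLRFilling.of_label {γ : Set (ℕ × ℕ)} {ν : ℕ → ℕ} {T φ : ℕ × ℕ → ℕ} (hγ : γ.Finite)
    (pos : ∀ c ∈ γ, 1 ≤ T c)
    (row_weak : ∀ i j j', (i, j) ∈ γ → (i, j') ∈ γ → j ≤ j' → T (i, j) ≤ T (i, j'))
    (col_strict : ∀ i i' j, (i, j) ∈ γ → (i', j) ∈ γ → i < i' → T (i, j) < T (i', j))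
    (inj : ∀ c ∈ γ, ∀ c' ∈ γ, φ c = φ c' → T c = T c' → c = c')
    (pred : ∀ c ∈ γ, ∀ v, 1 ≤ v → T c = v + 1 →
      ∃ c' ∈ γ, φ c' = φ c ∧ T c' = v ∧ readBefore c' c)
    (weight : ∀ t, Set.ncard (φ '' {c ∈ γ | T c = t + 1}) = ν t) :
    IsLRFilling γ ν T := by
  refine ⟨pos, ?_, row_weak, col_strict, ?_⟩
  · intro j hj
    rw [← weight, Nat.sub_add_cancel hj, Set.InjOn.ncard_image]
    rintro c ⟨hc, h1⟩ c' ⟨hc', h2⟩ h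
    exact inj c hc c' hc' h (h1.trans h2.symm)
  · intro c hc j hj
    have hinj : ∀ v, Set.InjOn φ {d ∈ γ | T d = v ∧ readBefore d c} := by
      rintro v x ⟨hx, h1, _⟩ y ⟨hy, h2, _⟩ h
      exact inj x hx y hy h (h1.trans h2.symm)
    rw [← Set.InjOn.ncard_image (hinj (j + 1)), ← Set.InjOn.ncard_image (hinj j)]
    refine Set.ncard_le_ncard ?_ ((hγ.subset (Set.sep_subset _ _)).image _)
    rintro _ ⟨x, ⟨hx, hT, hr⟩, rfl⟩
    obtain ⟨y, hy, h1, h2, h3⟩ := pred x hx j hj hT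
    exact ⟨y, ⟨hy, h2, readBefore_trans h3 hr⟩, h1⟩

/-- Filling every column of a skew shape with `1, 2, 3, …` from the top.  The skew shape is
written as `l' / m'`, so that its column lengths are `l j - m j`. -/
lemma LRcoeff_conj_pos {l m : ℕ → ℕ} (hl : IsPartition l) (hm : IsPartition m)
    (h : ∀ i, m i ≤ l i) :
    0 < LRcoeff (conj l) (conj m) (conj fun i => l i - m i) := by
  have hmem : ∀ i j, (i, j) ∈ skewCells (conj l) (conj m) ↔ m j ≤ i ∧ i < l j := by
    intro i j
    simp only [skewCells, Set.mem_ofPred_eq]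
    rw [lt_conj_iff hl, ← not_lt, lt_conj_iff hm, not_lt]
  rw [LRcoeff_pos_iff hl.conj]
  refine ⟨fun i => ?_, fun c => c.1 - m c.2 + 1, ?_⟩
  · exact Set.ncard_le_ncard (fun j (hj : i < m j) => lt_of_lt_of_le hj (h j)) (finite_lt hl.2 i)
  refine IsLRFilling.of_label (φ := fun c => c.2) (skewCells_finite hl.conj.2 _)
    (fun c _ => Nat.le_add_left _ _) ?_ ?_ ?_ ?_ ?_
  · intro i j j' _ _ hj
    have := hm.1 hj
    simp only
    omega
  · intro i i' j h1 h2 hi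
    rw [hmem] at h1 h2
    simp only
    omega
  · rintro ⟨i, j⟩ h1 ⟨i', j'⟩ h2 h3 h4
    rw [hmem] at h1 h2
    simp only at h3 h4
    subst h3
    rw [Prod.mk.injEq]
    omega
  · rintro ⟨i, j⟩ h1 v hv h2
    rw [hmem] at h1
    simp only at h2
    refine ⟨(i - 1, j), (hmem _ _).2 (by omega), rfl, by simp only; omega, ?_⟩
    simp only [readBefore]
    omega
  · intro t
    unfold conj
    congr 1
    ext j
    simp only [Set.mem_image, Set.mem_ofPred_eq, Prod.exists]
    constructor
    · rintro ⟨i, j', ⟨h1, h2⟩, rfl⟩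
      have h1 := (hmem _ _).1 h1
      omega
    · intro ht
      exact ⟨m j + t, j, ⟨(hmem _ _).2 (by omega), by omega⟩, rfl⟩

/-- The number of `i' ≤ i` with `c < d i'`. -/
def rank (d : ℕ → ℕ) (c i : ℕ) : ℕ := ((Finset.range (i + 1)).filter fun i' => c < d i').card

lemma rank_succ (d : ℕ → ℕ) (c i : ℕ) :
    rank d c (i + 1) = rank d c i + if c < d (i + 1) then 1 else 0 := by
  unfold rank
  rw [Finset.range_add_one, Finset.filter_insert]
  split_ifs
  · rw [Finset.card_insert_of_notMem (by simp)]
  · rfl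

lemma rank_mono (d : ℕ → ℕ) (c : ℕ) : Monotone (rank d c) :=
  monotone_nat_of_le_succ fun i => by rw [rank_succ]; exact Nat.le_add_right _ _

lemma rank_anti (d : ℕ → ℕ) (i : ℕ) : Antitone fun c => rank d c i := by
  intro c c' hc
  refine Finset.card_le_card fun x hx => ?_
  simp only [Finset.mem_filter] at hx ⊢
  exact ⟨hx.1, lt_of_le_of_lt hc hx.2⟩

lemma rank_lt {d : ℕ → ℕ} {c i i' : ℕ} (hi : i < i') (h : c < d i') :
    rank d c i < rank d c i' := by
  obtain ⟨k, rfl⟩ := Nat.exists_eq_succ_of_ne_zero (Nat.ne_zero_of_lt hi)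
  have := rank_mono d c (Nat.le_of_lt_succ hi)
  rw [Nat.succ_eq_add_one, rank_succ, if_pos h]
  omega

lemma exists_rank_eq {d : ℕ → ℕ} {c v : ℕ} (hv : 1 ≤ v) (i : ℕ) (h : v ≤ rank d c i) :
    ∃ i' ≤ i, c < d i' ∧ rank d c i' = v := by
  induction i with
  | zero =>
    have hr : rank d c 0 = if c < d 0 then 1 else 0 := by
      unfold rank
      rw [zero_add, Finset.range_one, Finset.filter_singleton]
      split_ifs <;> rfl
    rw [hr] at h
    split_ifs at h with h0
    · exact ⟨0, le_rfl, h0, by rw [hr, if_pos h0]; omega⟩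
    · omega
  | succ i ih =>
    by_cases hle : v ≤ rank d c i
    · obtain ⟨i', h1, h2⟩ := ih hle
      exact ⟨i', by omega, h2⟩
    · refine ⟨i + 1, le_rfl, ?_⟩
      rw [rank_succ] at h ⊢
      split_ifs at h ⊢ with h0
      · exact ⟨h0, by omega⟩
      · omega

/-- Right-justifying the rows of a skew shape and filling the resulting columns with
`1, 2, 3, …` from the top. -/
lemma LRcoeff_pos {l m : ℕ → ℕ} (hl : IsPartition l) (h : ∀ i, m i ≤ l i) :
    0 < LRcoeff l m (conj (conj fun i => l i - m i)) := by
  set d : ℕ → ℕ := fun i => l i - m i with hd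
  rw [LRcoeff_pos_iff hl]
  refine ⟨h, fun c => rank d (l c.1 - 1 - c.2) c.1, ?_⟩
  have hcd : ∀ i j, (i, j) ∈ skewCells l m → l i - 1 - j < d i := by
    rintro i j ⟨h1, h2⟩
    simp only [hd] at *
    omega
  have hcell : ∀ i c, c < d i → (i, l i - 1 - c) ∈ skewCells l m ∧
      l i - 1 - (l i - 1 - c) = c := by
    intro i c hc
    simp only [hd, skewCells, Set.mem_ofPred_eq] at *
    omega
  refine IsLRFilling.of_label (φ := fun c => l c.1 - 1 - c.2) (skewCells_finite hl.2 _)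
    ?_ ?_ ?_ ?_ ?_ ?_
  · rintro ⟨i, j⟩ hc
    refine Finset.card_pos.2 ⟨i, ?_⟩
    simp only [Finset.mem_filter, Finset.mem_range]
    exact ⟨Nat.lt_succ_self i, hcd i j hc⟩
  · intro i j j' _ _ hj
    exact rank_anti d i (by simp only; omega)
  · intro i i' j h1 h2 hi
    have hli := hl.1 hi.le
    refine lt_of_le_of_lt (rank_anti d i ?_) (rank_lt hi (hcd i' j h2))
    simp only
    omega
  · rintro ⟨i, j⟩ h1 ⟨i', j'⟩ h2 h3 h4
    simp only at h3 h4
    have e1 := hcd _ _ h1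
    have e2 := hcd _ _ h2
    rw [h3] at e1 h4
    rcases lt_trichotomy i i' with hi | hi | hi
    · have := rank_lt hi e2
      omega
    · subst hi
      have g1 : j < l i := h1.2
      have g2 : j' < l i := h2.2
      rw [Prod.mk.injEq]
      omega
    · have := rank_lt hi e1
      omega
  · rintro ⟨i, j⟩ h1 v hv h2
    simp only at h2
    obtain ⟨i', hi', hc, hr⟩ := exists_rank_eq (d := d) (c := l i - 1 - j) hv i (by omega)
    obtain ⟨g1, g2⟩ := hcell i' _ hc
    refine ⟨_, g1, g2, by simp only [g2]; exact hr, ?_⟩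
    have : i' ≠ i := by
      rintro rfl
      omega
    simp only [readBefore]
    omega
  · intro t
    obtain ⟨M, hM⟩ := hl.2
    have hdM : ∀ i, M + 1 ≤ i → d i = 0 := fun i hi => by
      simp only [hd, hM i (by omega)]
      omega
    change _ = Set.ncard {c | t < conj d c}
    congr 1
    ext c
    simp only [Set.mem_image, Set.mem_ofPred_eq, Prod.exists]
    rw [conj_eq_card hdM]
    change _ ↔ t < rank d c M
    constructor
    · rintro ⟨i, j, ⟨h1, h2⟩, rfl⟩
      have hi : i ≤ M := by
        by_contra hc
        have := hM i (by omega)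
        have := h1.2
        simp only at this
        omega
      have := rank_mono d (l i - 1 - j) hi
      omega
    · intro ht
      obtain ⟨i', -, hc, hr⟩ := exists_rank_eq (c := c) (v := t + 1) (by omega) M ht
      obtain ⟨g1, g2⟩ := hcell i' _ hc
      exact ⟨i', _, ⟨g1, by rw [g2]; exact hr⟩, g2⟩

lemma IsLRFilling.weight_pos {γ : Set (ℕ × ℕ)} {ν : ℕ → ℕ} {T : ℕ × ℕ → ℕ}
    (hT : IsLRFilling γ ν T) (hγ : γ.Finite) {c : ℕ × ℕ} (hc : c ∈ γ) : 0 < ν (T c - 1) := by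
  rw [← hT.weight (T c) (hT.pos c hc), Set.ncard_pos (hγ.subset (Set.sep_subset _ _))]
  exact ⟨c, hc, rfl⟩

lemma IsLRFilling.ncard_eq {γ : Set (ℕ × ℕ)} {ν : ℕ → ℕ} {T : ℕ × ℕ → ℕ}
    (hT : IsLRFilling γ ν T) (hγ : γ.Finite) (hν : ∃ M, ∀ i, M ≤ i → ν i = 0) :
    γ.ncard = psize ν := by
  obtain ⟨M, hM⟩ := hν
  rw [psize_eq_sum hM, Set.ncard_eq_toFinset_card γ hγ,
    Finset.card_eq_sum_card_fiberwise (f := fun c => T c - 1) (t := Finset.range M)]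
  · refine Finset.sum_congr rfl fun j _ => ?_
    have hw := hT.weight (j + 1) (Nat.le_add_left _ _)
    rw [Nat.add_sub_cancel] at hw
    rw [← hw, ← Set.ncard_coe_finset]
    congr 1
    ext c
    simp only [Finset.coe_filter, Set.Finite.mem_toFinset, Set.mem_ofPred_eq]
    refine and_congr_right fun hc => ?_
    have := hT.pos c hc
    omega
  · intro c hc
    simp only [Set.Finite.coe_toFinset] at hc
    simp only [Finset.coe_range, Set.mem_Iio]
    by_contra h
    have := hM _ (not_lt.1 h)
    have := hT.weight_pos hγ hc
    omega

lemma ncard_skewCells {l m : ℕ → ℕ} (hl : ∃ M, ∀ i, M ≤ i → l i = 0) (h : ∀ i, m i ≤ l i) :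
    psize m + (skewCells l m).ncard = psize l := by
  unfold psize
  rw [← Set.ncard_union_eq ?_ (cellsOf_finite (finite_of_le hl h)) (skewCells_finite hl m)]
  · congr 1
    ext ⟨i, j⟩
    have := h i
    simp only [cellsOf, skewCells, Set.mem_union, Set.mem_ofPred_eq]
    omega
  · rw [Set.disjoint_left]
    rintro ⟨i, j⟩ h1 h2
    simp only [cellsOf, skewCells, Set.mem_ofPred_eq] at h1 h2
    omega

lemma ncard_row (i x y : ℕ) : Set.ncard {c : ℕ × ℕ | c.1 = i ∧ x ≤ c.2 ∧ c.2 < y} = y - x := by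
  have : {c : ℕ × ℕ | c.1 = i ∧ x ≤ c.2 ∧ c.2 < y} =
      (fun j => (i, j)) '' (Finset.Ico x y : Set ℕ) := by
    ext ⟨i', j⟩
    simp only [Set.mem_ofPred_eq, Set.mem_image, Finset.coe_Ico, Set.mem_Ico, Prod.mk.injEq]
    constructor
    · rintro ⟨rfl, h⟩
      exact ⟨j, h, rfl, rfl⟩
    · rintro ⟨j', h, rfl, rfl⟩
      exact ⟨rfl, h⟩
  rw [this, Set.InjOn.ncard_image, Set.ncard_coe_finset, Nat.card_Ico]
  intro x _ y _ h
  exact (Prod.mk.inj h).2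

section Forward

variable {l m ν : ℕ → ℕ} {T : ℕ × ℕ → ℕ}

lemma IsLRFilling.head_row (hT : IsLRFilling (skewCells l m) ν T) (hl : IsPartition l) {j : ℕ}
    (hj : (0, j) ∈ skewCells l m) : T (0, j) = 1 := by
  have h1 := hT.le_row (skewCells_finite hl.2 m) 0 j hj
  have h2 := hT.pos _ hj
  omega

lemma IsLRFilling.head_le (hT : IsLRFilling (skewCells l m) ν T) (hl : IsPartition l) :
    l 0 ≤ m 0 + ν 0 := by
  have hγ := skewCells_finite hl.2 m
  have h := hT.weight 1 le_rfl
  have hsub : {c : ℕ × ℕ | c.1 = 0 ∧ m 0 ≤ c.2 ∧ c.2 < l 0} ⊆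
      {c ∈ skewCells l m | T c = 1} := by
    rintro ⟨i, j⟩ ⟨h1, h2⟩
    simp only at h1 h2
    subst h1
    exact ⟨h2, hT.head_row hl h2⟩
  have := Set.ncard_le_ncard hsub (hγ.subset (Set.sep_subset _ _))
  rw [ncard_row, h] at this
  simp only [Nat.sub_self] at this
  omega

lemma IsLRFilling.first_col (hT : IsLRFilling (skewCells l m) ν T) (hl : IsPartition l)
    (hm : IsPartition m) (s : ℕ) (hs : conj m 0 + s < conj l 0) :
    (conj m 0 + s, 0) ∈ skewCells l m ∧ s + 1 ≤ T (conj m 0 + s, 0) := by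
  have hmem : ∀ s, conj m 0 + s < conj l 0 → (conj m 0 + s, 0) ∈ skewCells l m := by
    intro s hs
    refine ⟨?_, (lt_conj_iff hl _ _).1 hs⟩
    simp only [eq_zero_of_conj_zero_le hm (Nat.le_add_right _ s), le_refl]
  refine ⟨hmem s hs, ?_⟩
  induction s with
  | zero => exact hT.pos _ (hmem 0 hs)
  | succ s ih =>
    have h1 := ih (by omega)
    have h2 := hT.col_strict _ (conj m 0 + (s + 1)) 0 (hmem s (by omega)) (hmem _ hs) (by omega)
    omega

lemma IsLRFilling.le_length (hT : IsLRFilling (skewCells l m) ν T) (hl : IsPartition l)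
    (hν : IsPartition ν) {c : ℕ × ℕ} (hc : c ∈ skewCells l m) : T c ≤ conj ν 0 := by
  have h1 := (lt_conj_iff hν _ _).2 (hT.weight_pos (skewCells_finite hl.2 m) hc)
  have h2 := hT.pos c hc
  omega

lemma IsLRFilling.length_le (hT : IsLRFilling (skewCells l m) ν T) (hl : IsPartition l)
    (hm : IsPartition m) (hν : IsPartition ν) : conj l 0 ≤ conj m 0 + conj ν 0 := by
  by_contra h
  obtain ⟨h1, h2⟩ := hT.first_col hl hm (conj ν 0) (by omega)
  have := hT.le_length hl hν h1
  omega

/-- If the first parts add up and the inner partition has a single part, the lower rows of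
the outer partition are those of the weight. -/
lemma IsLRFilling.eq_of_head_eq (hT : IsLRFilling (skewCells l m) ν T) (hl : IsPartition l)
    (hm1 : ∀ i, 1 ≤ i → m i = 0) (h : l 0 = m 0 + ν 0) (i : ℕ) (hi : 1 ≤ i) :
    ν i = l i := by
  have hγ := skewCells_finite hl.2 m
  have hw := hT.weight 1 le_rfl
  have hsub : {c : ℕ × ℕ | c.1 = 0 ∧ m 0 ≤ c.2 ∧ c.2 < l 0} ⊆
      {c ∈ skewCells l m | T c = 1} := by
    rintro ⟨i, j⟩ ⟨h1, h2⟩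
    simp only at h1 h2
    subst h1
    exact ⟨h2, hT.head_row hl h2⟩
  have heq := Set.eq_of_subset_of_ncard_le hsub
    (by rw [ncard_row, hw, Nat.sub_self]; omega) (hγ.subset (Set.sep_subset _ _))
  have hmem : ∀ i j, 1 ≤ i → ((i, j) ∈ skewCells l m ↔ j < l i) := by
    intro i j hi
    simp [skewCells, hm1 i hi]
  have hge : ∀ i j, (i + 1, j) ∈ skewCells l m → i + 2 ≤ T (i + 1, j) := by
    intro i
    induction i with
    | zero =>
      intro j hj
      have h1 := hT.pos _ hj
      by_contra hc
      have : (0 + 1, j) ∈ {c ∈ skewCells l m | T c = 1} := ⟨hj, by omega⟩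
      rw [← heq] at this
      simp at this
    | succ i ih =>
      intro j hj
      have hj' : (i + 1, j) ∈ skewCells l m := by
        rw [hmem _ _ (by omega)] at hj ⊢
        exact lt_of_lt_of_le hj (hl.1 (by omega))
      have h1 := ih j hj'
      have h2 := hT.col_strict _ _ j hj' hj (by omega)
      omega
  have hTi : ∀ i j, 1 ≤ i → (i, j) ∈ skewCells l m → T (i, j) = i + 1 := by
    intro i j hi hj
    obtain ⟨i, rfl⟩ := Nat.exists_eq_add_of_le' hi
    have h1 := hge i j hj
    have h2 := hT.le_row hγ _ j hj
    omega
  have hwi := hT.weight (i + 1) (by omega)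
  rw [Nat.add_sub_cancel] at hwi
  rw [← hwi, ← Nat.sub_zero (l i), ← ncard_row i 0 (l i)]
  congr 1
  ext ⟨i', j⟩
  simp only [Set.mem_ofPred_eq]
  constructor
  · rintro ⟨h1, h2⟩
    rcases Nat.eq_zero_or_pos i' with h0 | h0
    · subst h0
      have := hT.head_row hl h1
      omega
    · have := hTi i' j h0 h1
      obtain rfl : i' = i := by omega
      exact ⟨rfl, Nat.zero_le _, (hmem _ _ hi).1 h1⟩
  · rintro ⟨rfl, -, h2⟩
    have := (hmem i' j hi).2 h2
    exact ⟨this, hTi i' j hi this⟩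

/-- If the lengths add up and the inner partition is a single column, the rows of the weight
agree with those of the outer partition as long as they are nonzero. -/
lemma IsLRFilling.eq_of_length_eq (hT : IsLRFilling (skewCells l m) ν T) (hl : IsPartition l)
    (hm : IsPartition m) (hν : IsPartition ν) (hm0 : m 0 = 1)
    (h : conj l 0 = conj m 0 + conj ν 0) (i : ℕ) (hi : i < conj ν 0) : ν i = l i := by
  have hγ := skewCells_finite hl.2 m
  have hm1 : ∀ i, m i ≤ 1 := fun i => by
    have := hm.1 (Nat.zero_le i)
    omega
  have hpos : 0 < conj m 0 := (lt_conj_iff hm 0 0).2 (by omega)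
  have hmem : ∀ i j, 1 ≤ j → ((i, j) ∈ skewCells l m ↔ j < l i) := by
    intro i j hj
    have := hm1 i
    simp only [skewCells, Set.mem_ofPred_eq]
    omega
  have hge : ∀ i j, 1 ≤ j → (i, j) ∈ skewCells l m → i + 1 ≤ T (i, j) := by
    intro i j hj
    induction i with
    | zero => exact fun hc => hT.pos _ hc
    | succ i ih =>
      intro hc
      have hc' : (i, j) ∈ skewCells l m := by
        rw [hmem _ _ hj] at hc ⊢
        exact lt_of_lt_of_le hc (hl.1 (by omega))
      have h1 := ih hc'
      have h2 := hT.col_strict _ _ j hc' hc (by omega)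
      omega
  have hTj : ∀ i j, 1 ≤ j → (i, j) ∈ skewCells l m → T (i, j) = i + 1 := by
    intro i j hj hc
    have h1 := hge i j hj hc
    have h2 := hT.le_row hγ _ j hc
    omega
  have hup : ∀ u s, s + u + 1 = conj ν 0 → T (conj m 0 + s, 0) ≤ s + 1 := by
    intro u
    induction u with
    | zero =>
      intro s hs
      have := hT.le_length hl hν (hT.first_col hl hm s (by omega)).1
      omega
    | succ u ih =>
      intro s hs
      have h1 := ih (s + 1) (by omega)
      have h2 := hT.col_strict _ _ 0 (hT.first_col hl hm s (by omega)).1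
        (hT.first_col hl hm (s + 1) (by omega)).1 (by omega)
      omega
  have hcol : ∀ s, s < conj ν 0 → T (conj m 0 + s, 0) = s + 1 := by
    intro s hs
    have h1 := hup (conj ν 0 - s - 1) s (by omega)
    have h2 := (hT.first_col hl hm s (by omega)).2
    omega
  have hli : 1 ≤ l i := (lt_conj_iff hl i 0).1 (by omega)
  have hwi := hT.weight (i + 1) (by omega)
  rw [Nat.add_sub_cancel] at hwi
  have hset : {c ∈ skewCells l m | T c = i + 1} =
      {c : ℕ × ℕ | c.1 = i ∧ 1 ≤ c.2 ∧ c.2 < l i} ∪ {(conj m 0 + i, 0)} := by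
    ext ⟨i', j⟩
    simp only [Set.mem_ofPred_eq, Set.mem_union, Set.mem_singleton_iff, Prod.mk.injEq]
    constructor
    · rintro ⟨h1, h2⟩
      rcases Nat.eq_zero_or_pos j with h0 | h0
      · subst h0
        right
        have h3 : i' < conj l 0 := (lt_conj_iff hl i' 0).2 h1.2
        have h4 : conj m 0 ≤ i' := by
          by_contra hc
          have := (lt_conj_iff hm i' 0).1 (not_le.1 hc)
          have := h1.1
          simp only at this
          omega
        obtain ⟨s, rfl⟩ := Nat.exists_eq_add_of_le h4
        have := hcol s (by omega)
        omega
      · have := hTj i' j h0 h1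
        obtain rfl : i' = i := by omega
        exact Or.inl ⟨rfl, h0, (hmem _ _ h0).1 h1⟩
    · rintro (⟨rfl, h1, h2⟩ | ⟨rfl, rfl⟩)
      · have := (hmem i' j h1).2 h2
        exact ⟨this, hTj i' j h1 this⟩
      · exact ⟨(hT.first_col hl hm i (by omega)).1, hcol i hi⟩
  rw [← hwi, hset, Set.ncard_union_eq ?_ ?_ (Set.finite_singleton _), ncard_row,
    Set.ncard_singleton]
  · omega
  · rw [Set.disjoint_singleton_right]
    simp
  · refine (hγ.subset (Set.sep_subset _ fun c => T c = i + 1)).subset ?_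
    rw [hset]
    exact Set.subset_union_left

end Forward

/-! ### The factors and the product -/

lemma ofList_pair (x y i : ℕ) :
    ofList [x, y] i = if i = 0 then x else if i = 1 then y else 0 := by
  rcases i with _ | _ | i <;> simp [ofList]

lemma hookP_apply (x b i : ℕ) : hookP x b i = if i = 0 then x else if i ≤ b then 1 else 0 := by
  rcases i with _ | i
  · simp [hookP, ofList]
  · simp only [hookP, ofList, List.getD_cons_succ, Nat.succ_ne_zero, if_false]
    by_cases h : i < b
    · simp [List.getD, h, Nat.succ_le_of_lt h]
    · simp [List.getD, h]

lemma consPart_apply (x : ℕ) (β : ℕ → ℕ) (i : ℕ) :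
    consPart x β i = if i = 0 then x else β (i - 1) := rfl

lemma consPart_tail (f : ℕ → ℕ) : consPart (f 0) (fun i => f (i + 1)) = f := by
  funext i
  rcases i with _ | i <;> simp [consPart]

lemma consPart_inj {x : ℕ} {β β' : ℕ → ℕ} (h : consPart x β = consPart x β') : β = β' := by
  funext i
  simpa [consPart] using congrFun h (i + 1)

lemma ofList_triple_eq (x y z : ℕ) : ofList [x, y, z] = consPart x (ofList [y, z]) := by
  funext i
  rcases i with _ | i <;> simp [consPart, ofList]

lemma ofList_cons_hook_eq (x y b : ℕ) :
    ofList (x :: y :: List.replicate b 1) = consPart x (hookP y b) := by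
  funext i
  rcases i with _ | i <;> simp [consPart, hookP, ofList]

lemma isPartition_of_apply {f : ℕ → ℕ} (M : ℕ) (hM : ∀ i, M ≤ i → f i = 0)
    (h : ∀ i, f (i + 1) ≤ f i) : IsPartition f :=
  ⟨antitone_nat_of_succ_le h, M, hM⟩

lemma IsPartition.consPart {x : ℕ} {β : ℕ → ℕ} (hβ : IsPartition β) (h : β 0 ≤ x) :
    IsPartition (consPart x β) := by
  obtain ⟨ha, M, hM⟩ := hβ
  refine isPartition_of_apply (M + 1) (fun i hi => ?_) fun i => ?_
  · rw [consPart_apply, if_neg (by omega), hM _ (by omega)]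
  · rcases i with _ | i
    · simpa [consPart_apply] using h
    · simpa [consPart_apply] using ha (Nat.le_succ i)

lemma IsPartition.tail {f : ℕ → ℕ} (hf : IsPartition f) : IsPartition fun i => f (i + 1) := by
  obtain ⟨ha, M, hM⟩ := hf
  exact ⟨fun i j hij => ha (Nat.succ_le_succ hij), M, fun i hi => hM _ (by omega)⟩

lemma psize_consPart (x : ℕ) {β : ℕ → ℕ} (hβ : ∃ M, ∀ i, M ≤ i → β i = 0) :
    psize (consPart x β) = x + psize β := by
  obtain ⟨M, hM⟩ := hβ
  rw [psize_eq_sum hM, psize_eq_sum (f := consPart x β) (M := M + 1), Finset.sum_range_succ']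
  · simp [consPart_apply, add_comm]
  · intro i hi
    rw [consPart_apply, if_neg (by omega), hM _ (by omega)]

lemma psize_tail {f : ℕ → ℕ} (hf : IsPartition f) :
    psize f = f 0 + psize fun i => f (i + 1) := by
  conv_lhs => rw [← consPart_tail f]
  exact psize_consPart _ hf.tail.2

lemma isPartition_pair {x y : ℕ} (h : y ≤ x) : IsPartition (ofList [x, y]) := by
  refine isPartition_of_apply 2 (fun i hi => ?_) fun i => ?_
  · rw [ofList_pair, if_neg (by omega), if_neg (by omega)]
  · rcases i with _ | _ | i <;> simp [ofList_pair, h]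

lemma isPartition_hookP {x : ℕ} (b : ℕ) (h : 1 ≤ x) : IsPartition (hookP x b) := by
  refine isPartition_of_apply (b + 1) (fun i hi => ?_) fun i => ?_
  · rw [hookP_apply, if_neg (by omega), if_neg (by omega)]
  · rw [hookP_apply, hookP_apply, if_neg (Nat.succ_ne_zero i)]
    split_ifs <;> omega

lemma conj_pair_eq_hookP {x : ℕ} (h : 2 ≤ x) : conj (ofList [x - 1, 1]) = hookP 2 (x - 2) := by
  refine conj_eq_of_iff (isPartition_pair (by omega)) fun i j => ?_
  rw [ofList_pair, hookP_apply]
  split_ifs <;> omega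

lemma conj_mem_Bset {n t : ℕ} {f : ℕ → ℕ} (hf : f ∈ Bset n t) : conj f ∈ Bset n t := by
  obtain ⟨⟨hp, hs⟩, h0, h1⟩ := hf
  refine ⟨⟨hp.conj, by rw [psize_conj hp.2, hs]⟩, h1, ?_⟩
  rw [conj_conj hp]
  exact h0

/-- `P(m)` without `(m-1, 1)` and its conjugate. -/
def typeOne (m : ℕ) : Set (ℕ → ℕ) := Pset m \ {ofList [m - 1, 1], hookP 2 (m - 2)}

/-- The four partitions of `3a` whose conjugation closure is removed from `B_{3a}(2a)`. -/
def excluded (a : ℕ) : Set (ℕ → ℕ) :=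
  {ofList [2 * a, a - 1, 1], ofList (2 * a :: 2 :: List.replicate (a - 2) 1),
    ofList [2 * a - 1, a + 1], hookP (2 * a - 1) (a + 1)}

/-- `B_{3a}(2a)` without the conjugation closure of `excluded a`. -/
noncomputable def typeFive (a : ℕ) : Set (ℕ → ℕ) :=
  Bset (3 * a) (2 * a) \ conjClosure (excluded a)

lemma conj_mem_typeOne {m : ℕ} (hm : 2 ≤ m) {f : ℕ → ℕ} (hf : f ∈ typeOne m) :
    conj f ∈ typeOne m := by
  obtain ⟨⟨hp, hs⟩, hne⟩ := hf
  refine ⟨⟨hp.conj, by rw [psize_conj hp.2, hs]⟩, ?_⟩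
  have hpair : IsPartition (ofList [m - 1, 1]) := isPartition_pair (by omega)
  rintro (h | h)
  · exact hne (Or.inr (by rw [Set.mem_singleton_iff, ← conj_pair_eq_hookP hm, ← h, conj_conj hp]))
  · rw [Set.mem_singleton_iff, ← conj_pair_eq_hookP hm] at h
    exact hne (Or.inl (conj_injective hp hpair h))

lemma excluded_props {a : ℕ} (ha : 4 ≤ a) {g : ℕ → ℕ} (hg : g ∈ excluded a) :
    IsPartition g ∧ 2 * a - 1 ≤ g 0 ∧ conj g 0 ≤ a + 2 := by
  have key : IsPartition g ∧ 2 * a - 1 ≤ g 0 ∧ g (a + 2) = 0 := by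
    rcases hg with h | h | h | h <;> subst h
    · rw [ofList_triple_eq]
      refine ⟨(isPartition_pair (by omega)).consPart ?_, ?_, ?_⟩
      · simp only [ofList_pair, if_true]
        omega
      · simp [consPart_apply]
      · rw [consPart_apply, ofList_pair, if_neg (by omega), if_neg (by omega), if_neg (by omega)]
    · rw [ofList_cons_hook_eq]
      refine ⟨(isPartition_hookP _ (by omega)).consPart ?_, ?_, ?_⟩
      · simp only [hookP_apply, if_true]
        omega
      · simp [consPart_apply]
      · rw [consPart_apply, hookP_apply]
        simp only [Nat.add_eq_zero_iff]
        split_ifs <;> omega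
    · refine ⟨isPartition_pair (by omega), by simp [ofList_pair], by simp [ofList_pair]⟩
    · refine ⟨isPartition_hookP _ (by omega), by simp [hookP_apply], by simp [hookP_apply]⟩
  refine ⟨key.1, key.2.1, ?_⟩
  by_contra hc
  have := (lt_conj_iff key.1 (a + 2) 0).1 (not_le.1 hc)
  omega

lemma conj_mem_typeFive {a : ℕ} (ha : 4 ≤ a) {f : ℕ → ℕ} (hf : f ∈ typeFive a) :
    conj f ∈ typeFive a := by
  obtain ⟨hB, hne⟩ := hf
  refine ⟨conj_mem_Bset hB, ?_⟩
  rintro (h | ⟨g, hg, h⟩)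
  · exact hne (Or.inr ⟨_, h, conj_conj hB.1.1⟩)
  · rw [← conj_injective (excluded_props ha hg).1 hB.1.1 h] at hne
    exact hne (Or.inl hg)

lemma mem_typeFive_of_small {a : ℕ} (ha : 4 ≤ a) {f : ℕ → ℕ}
    (hf : f ∈ Bset (3 * a) (2 * a - 2)) : f ∈ typeFive a := by
  obtain ⟨hP, h0, h1⟩ := hf
  refine ⟨⟨hP, by omega, by omega⟩, ?_⟩
  rintro (h | ⟨g, hg, rfl⟩)
  · have := (excluded_props ha h).2.1
    omega
  · have := excluded_props ha hg
    rw [conj_conj this.1] at h1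
    omega

lemma mem_typeFive_of_head {a : ℕ} (ha : 4 ≤ a) {f : ℕ → ℕ} (hf : f ∈ Pset (3 * a))
    (h0 : 2 * a - 1 ≤ f 0) (h0' : f 0 ≤ 2 * a) (hne : f ∉ excluded a) : f ∈ typeFive a := by
  have hlen : conj f 0 ≤ 2 * a := by
    rcases Nat.eq_zero_or_pos (conj f 0) with h | h
    · omega
    · have := head_add_conj_le hf.1 h
      have := hf.2
      omega
  refine ⟨⟨hf, h0', hlen⟩, ?_⟩
  rintro (h | ⟨g, hg, rfl⟩)
  · exact hne h
  · have := (excluded_props ha hg).2.2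
    omega

/-- The partitions on the right-hand side that are not in `B_{m+3a}(m+2a-1)`, up to
conjugation. -/
def longRows (m a : ℕ) : Set (ℕ → ℕ) :=
  consPart (m + 2 * a) '' (Pset a \ {ofList [a - 1, 1], hookP 2 (a - 2)})

lemma consPart_tail_mem_longRows {m a : ℕ} {l ν : ℕ → ℕ} (hl : l ∈ Pset (m + 3 * a))
    (h0 : l 0 = m + 2 * a) (hν : ν ∈ typeFive a) (hν0 : ν 0 = 2 * a)
    (h : ∀ i, 1 ≤ i → ν i = l i) : l ∈ longRows m a := by
  have htail : consPart (2 * a) (fun i => l (i + 1)) = ν := by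
    funext i
    rcases i with _ | i
    · simp [consPart_apply, hν0]
    · simp [consPart_apply, h (i + 1) (by omega)]
  refine ⟨fun i => l (i + 1), ⟨⟨hl.1.tail, ?_⟩, ?_⟩, ?_⟩
  · have h1 := psize_tail hl.1
    have h2 := hl.2
    omega
  · intro hbad
    refine hν.2 (Or.inl ?_)
    rw [← htail]
    rcases hbad with hb | hb
    · rw [hb, ← ofList_triple_eq]
      exact Or.inl rfl
    · rw [Set.mem_singleton_iff] at hb
      rw [hb, ← ofList_cons_hook_eq]
      exact Or.inr (Or.inl rfl)
  · rw [← h0, consPart_tail]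

lemma head_le_psize {f : ℕ → ℕ} (hf : IsPartition f) : f 0 ≤ psize f := by
  have := psize_tail hf
  omega

lemma eq_zero_of_head_eq_psize {f : ℕ → ℕ} (hf : IsPartition f) (h : psize f ≤ f 0) (i : ℕ)
    (hi : 1 ≤ i) : f i = 0 := by
  have h1 := psize_tail hf
  have h2 := sum_le_psize hf.tail.2 {i - 1}
  rw [Finset.sum_singleton, Nat.sub_add_cancel hi] at h2
  omega

lemma star_subset {m a : ℕ} (hm : 2 ≤ m) (ha : 4 ≤ a) {l : ℕ → ℕ}
    (hl : l ∈ starOp (typeOne m) (typeFive a)) :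
    l ∈ Bset (m + 3 * a) (m + 2 * a - 1) ∪ conjClosure (longRows m a) := by
  obtain ⟨hp, μ, hμ, ν, hν, hpos⟩ := hl
  obtain ⟨hle, T, hT⟩ := (LRcoeff_pos_iff hp).1 hpos
  have hμp := hμ.1.1
  have hμs := hμ.1.2
  obtain ⟨⟨⟨hνp, hνs⟩, hν0, hν1⟩, -⟩ := id hν
  have hsize : psize l = m + 3 * a := by
    rw [← ncard_skewCells hp.2 hle, hT.ncard_eq (skewCells_finite hp.2 μ) hνp.2, hμs, hνs]
  have h0 := hT.head_le hp
  have h1 := hT.length_le hp hμp hνp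
  have hμ0 := head_le_psize hμp
  have hμ1 := head_le_psize hμp.conj
  rw [psize_conj hμp.2] at hμ1
  by_cases hN : l 0 = m + 2 * a
  · refine Or.inr (Or.inl ?_)
    exact consPart_tail_mem_longRows ⟨hp, hsize⟩ hN hν (by omega) (hT.eq_of_head_eq hp
      (eq_zero_of_head_eq_psize hμp (by omega)) (by omega))
  by_cases hN' : conj l 0 = m + 2 * a
  · refine Or.inr (Or.inr ⟨conj l, ?_, conj_conj hp⟩)
    have hμ2 := eq_zero_of_head_eq_psize hμp.conj (by rw [psize_conj hμp.2]; omega) 1 le_rfl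
    have hμ3 : μ 0 = 1 := by
      have e1 := (lt_conj_iff hμp 0 1)
      have e2 := (lt_conj_iff hμp 0 0)
      omega
    have hlν := hT.eq_of_length_eq hp hμp hνp hμ3 (by omega)
    refine consPart_tail_mem_longRows (ν := conj ν)
      ⟨hp.conj, by rw [psize_conj hp.2, hsize]⟩ hN' (conj_mem_typeFive ha hν) (by omega) ?_
    intro j hj
    refine eq_of_lt_iff fun i => ?_
    rw [lt_conj_iff hνp, lt_conj_iff hp]
    by_cases hi : i < conj ν 0
    · rw [hlν i hi]
    · have e1 := eq_zero_of_conj_zero_le hνp (not_lt.1 hi)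
      have e2 : ¬ j < l i := by
        intro hc
        have e3 := head_le_psize hp.conj.tail
        have e4 := psize_tail hp.conj
        rw [psize_conj hp.2] at e4
        have e5 := (lt_conj_iff hp i 1).2 (by omega)
        simp only [zero_add] at e3
        omega
      omega
  · exact Or.inl ⟨⟨hp, hsize⟩, by omega, by omega⟩

/-! ### Producing elements of the product -/

/-- `l` contains a partition from `typeOne m` such that sorting the row lengths of the
difference gives a partition from `typeFive a`. -/
def HasGoodRows (m a : ℕ) (l : ℕ → ℕ) : Prop :=
  ∃ μ ∈ typeOne m, (∀ i, μ i ≤ l i) ∧ conj (conj fun i => l i - μ i) ∈ typeFive a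

lemma HasGoodRows.mem_star {m a : ℕ} {l : ℕ → ℕ} (h : HasGoodRows m a l) (hl : IsPartition l) :
    l ∈ starOp (typeOne m) (typeFive a) := by
  obtain ⟨μ, hμ, hle, hν⟩ := h
  exact ⟨hl, μ, hμ, _, hν, LRcoeff_pos hl hle⟩

lemma HasGoodRows.conj_mem_star {m a : ℕ} (hm : 2 ≤ m) (ha : 4 ≤ a) {l : ℕ → ℕ}
    (h : HasGoodRows m a l) (hl : IsPartition l) :
    conj l ∈ starOp (typeOne m) (typeFive a) := by
  obtain ⟨μ, hμ, hle, hν⟩ := h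
  have hd := conj_isPartition (sub_finite (m := μ) hl.2)
  have hν' := conj_mem_typeFive ha hν
  rw [conj_conj hd] at hν'
  exact ⟨hl.conj, conj μ, conj_mem_typeOne hm hμ, _, hν', LRcoeff_conj_pos hl hμ.1.1 hle⟩

lemma psize_update_succ {f : ℕ → ℕ} (hf : ∃ M, ∀ i, M ≤ i → f i = 0) (i : ℕ) :
    psize (Function.update f i (f i + 1)) = psize f + 1 := by
  obtain ⟨M, hM⟩ := hf
  have hi : i ∈ Finset.range (max M (i + 1)) := Finset.mem_range.2 (by omega)
  rw [psize_eq_sum (f := f) (M := max M (i + 1)) (fun j hj => hM j (by omega)),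
    psize_eq_sum (M := max M (i + 1)), Finset.sum_update_of_mem hi,
    Finset.sum_eq_add_sum_sdiff_singleton_of_mem hi f]
  · ring
  · intro j hj
    rw [Function.update_of_ne (by omega), hM j (by omega)]

/-- Between two nested partitions there are partitions of every intermediate size. -/
lemma exists_partition_between {l : ℕ → ℕ} (hl : IsPartition l) {m : ℕ} (hm : m ≤ psize l) :
    ∀ (r : ℕ) (μ₀ : ℕ → ℕ), IsPartition μ₀ → (∀ i, μ₀ i ≤ l i) → psize μ₀ + r = m →
      ∃ μ, IsPartition μ ∧ (∀ i, μ₀ i ≤ μ i) ∧ (∀ i, μ i ≤ l i) ∧ psize μ = m := by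
  intro r
  induction r with
  | zero => exact fun μ₀ h0 hle hs => ⟨μ₀, h0, fun i => le_rfl, hle, hs⟩
  | succ r ih =>
    intro μ₀ h0 hle hs
    have hex : ∃ i, μ₀ i < l i := by
      by_contra! hc
      have := psize_le_psize h0.2 hc
      omega
    set i := Nat.find hex with hi
    have hlt : μ₀ i < l i := Nat.find_spec hex
    have hmin : ∀ j < i, l j ≤ μ₀ j := fun j hj => not_lt.1 (Nat.find_min hex hj)
    have hle' : ∀ j, Function.update μ₀ i (μ₀ i + 1) j ≤ l j := by
      intro j
      by_cases hj : j = i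
      · rw [hj, Function.update_self]
        exact hlt
      · rw [Function.update_of_ne hj]
        exact hle j
    have hge : ∀ j, μ₀ j ≤ Function.update μ₀ i (μ₀ i + 1) j := by
      intro j
      by_cases hj : j = i
      · rw [hj, Function.update_self]
        exact Nat.le_succ _
      · rw [Function.update_of_ne hj]
    have hanti : Antitone (Function.update μ₀ i (μ₀ i + 1)) := by
      refine antitone_nat_of_succ_le fun j => ?_
      by_cases hj : j + 1 = i
      · refine (hle' (j + 1)).trans (le_trans ?_ (hge j))
        exact (hl.1 (Nat.le_succ j)).trans (hmin j (by omega))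
      · rw [Function.update_of_ne hj]
        exact (h0.1 (Nat.le_succ j)).trans (hge j)
    obtain ⟨μ, h1, h2, h3, h4⟩ := ih (Function.update μ₀ i (μ₀ i + 1))
      ⟨hanti, finite_of_le hl.2 hle'⟩ hle' (by rw [psize_update_succ h0.2]; omega)
    exact ⟨μ, h1, fun j => (hge j).trans (h2 j), h3, h4⟩

lemma conj_conj_mem_typeFive {a : ℕ} (ha : 4 ≤ a) {d : ℕ → ℕ}
    (hd : ∃ M, ∀ i, M ≤ i → d i = 0) (hs : psize d = 3 * a) (hrow : ∀ i, d i ≤ 2 * a - 2)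
    (S : Finset ℕ) (hS : S.card ≤ 2 * a - 2) (hsupp : ∀ i, i ∉ S → d i = 0) :
    conj (conj d) ∈ typeFive a := by
  have hp := conj_isPartition hd
  refine mem_typeFive_of_small ha ⟨⟨hp.conj, ?_⟩, ?_, ?_⟩
  · rw [psize_conj hp.2, psize_conj hd, hs]
  · by_contra hc
    have h1 := (lt_conj_iff hp _ 0).1 (not_le.1 hc)
    unfold conj at h1
    obtain ⟨i, hi⟩ := (Set.ncard_pos (finite_lt hd _)).1 h1
    exact absurd (hrow i) (not_le.2 hi)
  · rw [conj_conj hp]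
    refine le_trans ?_ hS
    unfold conj
    rw [← Set.ncard_coe_finset]
    refine Set.ncard_le_ncard (fun i hi => ?_) S.finite_toSet
    by_contra hc
    exact absurd (hsupp i hc) (Nat.pos_iff_ne_zero.1 hi)

lemma psize_max_le {f g : ℕ → ℕ} (hf : ∃ M, ∀ i, M ≤ i → f i = 0)
    (hg : ∃ M, ∀ i, M ≤ i → g i = 0) :
    psize (fun i => max (f i) (g i)) ≤ psize f + psize g := by
  obtain ⟨M, h1, h2⟩ := exists_common_bound hf hg
  rw [psize_eq_sum h1, psize_eq_sum h2, psize_eq_sum (M := M), ← Finset.sum_add_distrib]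
  · exact Finset.sum_le_sum fun i _ => max_le (Nat.le_add_right _ _) (Nat.le_add_left _ _)
  · intro i hi
    rw [h1 i hi, h2 i hi, max_self]

lemma mem_typeOne_of_shape {m : ℕ} {μ : ℕ → ℕ} (hμ : μ ∈ Pset m)
    (h : 2 ≤ μ 1 ∨ 3 ≤ μ 0 ∧ 1 ≤ μ 2) : μ ∈ typeOne m := by
  refine ⟨hμ, ?_⟩
  rintro (rfl | rfl)
  · rw [ofList_pair, ofList_pair, ofList_pair] at h
    simp at h
  · rw [hookP_apply, hookP_apply, hookP_apply] at h
    simp only [if_true, one_ne_zero, if_false] at h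
    split_ifs at h <;> omega

/-- A small partition inside `κ` for which the difference has few, short rows can be enlarged to
a witness for `HasGoodRows`. -/
lemma hasGoodRows_of_floor {m a : ℕ} (ha : 4 ≤ a) {κ μ₀ : ℕ → ℕ} (hκ : κ ∈ Pset (m + 3 * a))
    (h0 : IsPartition μ₀) (hle : ∀ i, μ₀ i ≤ κ i) (hs : psize μ₀ + 5 ≤ m)
    (hshape : 2 ≤ κ 1 ∨ 3 ≤ κ 0 ∧ 1 ≤ κ 2) (hrow : ∀ i, κ i ≤ μ₀ i + (2 * a - 2))
    (S : Finset ℕ) (hS : S.card ≤ 2 * a - 2) (hsupp : ∀ i, i ∉ S → κ i ≤ μ₀ i) :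
    HasGoodRows m a κ := by
  have hτ : ∃ τ, IsPartition τ ∧ psize τ ≤ 5 ∧ (∀ i, τ i ≤ κ i) ∧
      (2 ≤ τ 1 ∨ 3 ≤ τ 0 ∧ 1 ≤ τ 2) := by
    rcases hshape with h | h
    · have h' := hκ.1.1 (Nat.zero_le 1)
      refine ⟨ofList [2, 2], isPartition_pair le_rfl, ?_, fun i => ?_, ?_⟩
      · rw [psize_eq_sum (M := 2)]
        · simp [Finset.sum_range_succ, ofList_pair]
        · intro i hi
          rw [ofList_pair, if_neg (by omega), if_neg (by omega)]
      · rw [ofList_pair]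
        split_ifs with h1 h2
        · rw [h1]
          omega
        · rw [h2]
          omega
        · exact Nat.zero_le _
      · simp [ofList_pair]
    · refine ⟨hookP 3 2, isPartition_hookP 2 (by omega), ?_, fun i => ?_, ?_⟩
      · rw [psize_eq_sum (M := 3)]
        · simp [Finset.sum_range_succ, hookP_apply]
        · intro i hi
          rw [hookP_apply, if_neg (by omega), if_neg (by omega)]
      · rw [hookP_apply]
        split_ifs with h1 h2
        · rw [h1]
          exact h.1
        · exact h.2.trans (hκ.1.1 h2)
        · exact Nat.zero_le _
      · simp [hookP_apply]
  obtain ⟨τ, hτ, hτs, hτle, hτshape⟩ := hτ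
  have h1s := psize_max_le h0.2 hτ.2
  have hκs := hκ.2
  have h1le : ∀ i, (fun i => max (μ₀ i) (τ i)) i ≤ κ i := fun i => max_le (hle i) (hτle i)
  obtain ⟨μ, hμ, hμ1, hμle, hμs⟩ := exists_partition_between hκ.1 (m := m) (by omega)
    (m - psize fun i => max (μ₀ i) (τ i)) (fun i => max (μ₀ i) (τ i))
    ⟨fun i j hij => max_le_max (h0.1 hij) (hτ.1 hij), finite_of_le hκ.1.2 h1le⟩ h1le (by omega)
  have hμ0 : ∀ i, μ₀ i ≤ μ i := fun i => (le_max_left _ _).trans (hμ1 i)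
  have hμτ : ∀ i, τ i ≤ μ i := fun i => (le_max_right _ _).trans (hμ1 i)
  refine ⟨μ, mem_typeOne_of_shape ⟨hμ, hμs⟩ ?_, hμle,
    conj_conj_mem_typeFive ha (sub_finite hκ.1.2) ?_ (fun i => ?_) S hS fun i hi => ?_⟩
  · have e0 := hμτ 0
    have e1 := hμτ 1
    have e2 := hμτ 2
    omega
  · have := psize_sub_add hκ.1.2 hμle
    omega
  · have e1 := hrow i
    have e2 := hμ0 i
    omega
  · have e1 := hsupp i hi
    have e2 := hμ0 i
    omega

lemma isPartition_row (m : ℕ) : IsPartition (consPart m fun _ => 0) :=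
  IsPartition.consPart ⟨fun _ _ _ => le_rfl, 0, fun _ _ => rfl⟩ (Nat.zero_le m)

lemma row_mem_typeOne {m : ℕ} (hm : 3 ≤ m) : (consPart m fun _ => 0) ∈ typeOne m := by
  refine ⟨⟨isPartition_row m, ?_⟩, ?_⟩
  · rw [psize_consPart m ⟨0, fun _ _ => rfl⟩, psize_eq_sum (M := 0) fun _ _ => rfl]
    simp
  · rintro (h | h)
    · have := congrFun h 1
      simp [consPart_apply, ofList_pair] at this
    · have := congrFun h 1
      simp only [consPart_apply, hookP_apply, one_ne_zero, if_false] at this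
      split_ifs at this
      omega

lemma hasGoodRows_of_row {m a : ℕ} (hm : 3 ≤ m) {κ : ℕ → ℕ} (h0 : m ≤ κ 0)
    (h : conj (conj (consPart (κ 0 - m) fun i => κ (i + 1))) ∈ typeFive a) :
    HasGoodRows m a κ := by
  refine ⟨_, row_mem_typeOne hm, fun i => ?_, ?_⟩
  · rw [consPart_apply]
    split_ifs with hi
    · rwa [hi]
    · exact Nat.zero_le _
  · convert h using 3
    funext i
    rcases i with _ | i <;> simp [consPart_apply]

lemma psize_le_head {f : ℕ → ℕ} (hf : IsPartition f) : psize f ≤ f 0 + conj f 0 * f 1 := by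
  rw [psize_tail hf, psize_eq_sum (M := conj f 0)]
  · refine Nat.add_le_add_left ((Finset.sum_le_card_nsmul _ _ (f 1) fun i _ => ?_).trans ?_) _
    · exact hf.1 (by omega)
    · simp
  · intro i hi
    exact eq_zero_of_conj_zero_le hf (by omega)

lemma hasGoodRows_of_short {m a : ℕ} (hm : 5 ≤ m) (ha : 10 ≤ a) {κ : ℕ → ℕ}
    (hκ : κ ∈ Pset (m + 3 * a)) (hlen : conj κ 0 ≤ 2 * a - 2) (h0 : κ 0 ≤ m + (2 * a - 2)) :
    HasGoodRows m a κ := by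
  have hκs := hκ.2
  have hsupp : ∀ i, i ∉ Finset.range (conj κ 0) → κ i = 0 := fun i hi =>
    eq_zero_of_conj_zero_le hκ.1 (by simpa using hi)
  have hpair := sum_le_psize hκ.1.2 {0, 1}
  rw [Finset.sum_pair zero_ne_one] at hpair
  by_cases hbig : κ 0 ≤ m + (2 * a - 2) - 5
  · have hle : ∀ i, (fun i => κ i - (2 * a - 2)) i ≤ κ i := fun i => Nat.sub_le _ _
    have h0p : IsPartition fun i => κ i - (2 * a - 2) :=
      ⟨fun i j hij => Nat.sub_le_sub_right (hκ.1.1 hij) _, finite_of_le hκ.1.2 hle⟩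
    refine hasGoodRows_of_floor (by omega) hκ h0p hle ?_ ?_
      (fun i => by omega) (Finset.range (conj κ 0)) (by simpa using hlen)
      (fun i hi => by rw [hsupp i hi]; exact Nat.zero_le _)
    · by_cases h1 : κ 1 ≤ 2 * a - 2
      · rw [psize_tail h0p, psize_eq_sum (M := 0)]
        · simp only [Finset.range_zero, Finset.sum_empty]
          omega
        · intro i _
          have := hκ.1.1 (show 1 ≤ i + 1 by omega)
          omega
      · have e1 := psize_sub_add hκ.1.2 hle
        have e2 := sum_le_psize (sub_finite (m := fun i => κ i - (2 * a - 2)) hκ.1.2) {0, 1}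
        rw [Finset.sum_pair zero_ne_one] at e2
        have e3 := hκ.1.1 (Nat.zero_le 1)
        omega
    · by_contra! hc
      have h1 : κ 1 ≤ 1 := by omega
      have e1 := psize_le_head hκ.1
      have e2 : conj κ 0 * κ 1 ≤ conj κ 0 := by
        simpa using Nat.mul_le_mul_left (conj κ 0) h1
      have e3 : κ 2 = 0 := by omega
      have e4 := lt_conj_iff hκ.1 2 0
      omega
  · refine hasGoodRows_of_row (by omega) (by omega) (conj_conj_mem_typeFive (by omega) ?_ ?_ ?_
      (Finset.range (conj κ 0)) (by simpa using hlen) ?_)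
    · obtain ⟨M, hM⟩ := hκ.1.2
      refine ⟨M + 1, fun i hi => ?_⟩
      rw [consPart_apply, if_neg (by omega)]
      exact hM _ (by omega)
    · rw [psize_consPart _ hκ.1.tail.2]
      have := psize_tail hκ.1
      omega
    · intro i
      rw [consPart_apply]
      split_ifs with hi
      · omega
      · have := hκ.1.1 (show 1 ≤ i - 1 + 1 by omega)
        omega
    · intro i hi
      have e := hsupp i hi
      rw [consPart_apply]
      split_ifs with h
      · rw [h] at e
        omega
      · rwa [Nat.sub_add_cancel (by omega)]

lemma le_sum_of_head {S : Finset ℕ} {d : ℕ → ℕ} {s t : ℕ} (hs : s ∈ S) (hd : t ≤ d s)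
    (h : ∀ i ∈ S, 1 ≤ d i) : t + (S.card - 1) ≤ ∑ i ∈ S, d i := by
  rw [← Finset.add_sum_erase S d hs, ← Finset.card_erase_of_mem hs, Finset.card_eq_sum_ones]
  exact Nat.add_le_add hd (Finset.sum_le_sum fun i hi => h i (Finset.mem_of_mem_erase hi))

/-- A floor whose complement in `κ` has exactly `2a - 2` nonempty rows, one of which has length
`2a - 2`, is small enough. -/
lemma psize_floor_le {m a : ℕ} (ha : 10 ≤ a) {κ μ₀ : ℕ → ℕ} (hκ : κ ∈ Pset (m + 3 * a))
    (hle : ∀ i, μ₀ i ≤ κ i) {S : Finset ℕ} (hS : S.card = 2 * a - 2) {s : ℕ} (hs : s ∈ S)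
    (hd : 2 * a - 2 ≤ κ s - μ₀ s) (h : ∀ i ∈ S, μ₀ i < κ i) : psize μ₀ + 5 ≤ m := by
  have e1 := le_sum_of_head (d := fun i => κ i - μ₀ i) hs hd fun i hi => by
    have := h i hi
    omega
  have e2 := sum_le_psize (sub_finite (m := μ₀) hκ.1.2) S
  have e3 := psize_sub_add hκ.1.2 hle
  have e4 := hκ.2
  omega

lemma hasGoodRows_of_wide {m a : ℕ} (ha : 10 ≤ a) {κ : ℕ → ℕ} (hκ : κ ∈ Pset (m + 3 * a))
    (h0 : 2 * a - 2 < κ 0) (hlen : 2 * a - 2 < conj κ 0)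
    (hρ : 2 * a - 2 ≤ κ (conj κ 0 - (2 * a - 2))) : HasGoodRows m a κ := by
  set t := 2 * a - 2 with ht
  set L := conj κ 0 with hL
  set μ₀ : ℕ → ℕ := fun i => if i < L - t then κ i else κ i - t with hμ₀
  have hle : ∀ i, μ₀ i ≤ κ i := by
    intro i
    simp only [hμ₀]
    split_ifs <;> omega
  have hκL : ∀ i, i < L ↔ 0 < κ i := fun i => lt_conj_iff hκ.1 i 0
  have hp : IsPartition μ₀ := by
    refine ⟨fun i j hij => ?_, finite_of_le hκ.1.2 hle⟩
    have := hκ.1.1 hij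
    simp only [hμ₀]
    split_ifs <;> omega
  have hcard : (Finset.Ico (L - t) L).card = t := by
    rw [Nat.card_Ico]
    omega
  refine hasGoodRows_of_floor (by omega) hκ hp hle ?_ ?_ (fun i => ?_) (Finset.Ico (L - t) L)
    hcard.le fun i hi => ?_
  · refine psize_floor_le ha hκ hle hcard (s := L - t) (by simp; omega) ?_ fun i hi => ?_
    · simp only [hμ₀, lt_irrefl, if_false]
      omega
    · rw [Finset.mem_Ico] at hi
      have := (hκL i).1 hi.2
      simp only [hμ₀]
      rw [if_neg (by omega)]
      omega
  · have := hκL 2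
    omega
  · simp only [hμ₀]
    split_ifs <;> omega
  · rw [Finset.mem_Ico] at hi
    have := hκL i
    simp only [hμ₀]
    split_ifs <;> omega

lemma hasGoodRows_conj_of_narrow {m a : ℕ} (ha : 10 ≤ a) {κ : ℕ → ℕ}
    (hκ : κ ∈ Pset (m + 3 * a)) (h0 : 2 * a - 2 < κ 0) (hlen : 2 * a - 2 < conj κ 0)
    (hρ : κ (conj κ 0 - (2 * a - 2)) < 2 * a - 2) : HasGoodRows m a (conj κ) := by
  set t := 2 * a - 2 with ht
  set η := conj κ with hη
  set ρ := κ (η 0 - t) with hρdef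
  set b := t - ρ with hb
  set K := κ 0 with hK
  have hηP : η ∈ Pset (m + 3 * a) := ⟨hκ.1.conj, by rw [hη, psize_conj hκ.1.2, hκ.2]⟩
  have hηκ : ∀ i j, i < η j ↔ j < κ i := fun i j => lt_conj_iff hκ.1 i j
  have hηL : ∀ i, η i ≤ η 0 := fun i => hηP.1.1 (Nat.zero_le i)
  set μ₀ : ℕ → ℕ := fun i => if i < K - b then min (η i) (η 0 - t) else η i - t with hμ₀
  have hle : ∀ i, μ₀ i ≤ η i := by
    intro i
    simp only [hμ₀]
    split_ifs <;> omega
  have hp : IsPartition μ₀ := by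
    refine ⟨fun i j hij => ?_, finite_of_le hηP.1.2 hle⟩
    have e1 := hηP.1.1 hij
    have e2 := hηL j
    simp only [hμ₀]
    split_ifs <;> omega
  have hρ1 : 0 < ρ := (hηκ (η 0 - t) 0).1 (by omega)
  have hdisj : Disjoint (Finset.range ρ) (Finset.Ico (K - b) K) := by
    rw [Finset.disjoint_left]
    intro i hi hi'
    rw [Finset.mem_range] at hi
    rw [Finset.mem_Ico] at hi'
    omega
  have hcard : (Finset.range ρ ∪ Finset.Ico (K - b) K).card = t := by
    rw [Finset.card_union_of_disjoint hdisj, Finset.card_range, Nat.card_Ico]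
    omega
  refine hasGoodRows_of_floor (by omega) hηP hp hle ?_ ?_ (fun i => ?_)
    (Finset.range ρ ∪ Finset.Ico (K - b) K) hcard.le fun i hi => ?_
  · refine psize_floor_le ha hηP hle hcard (s := 0) (by simp; omega) ?_ fun i hi => ?_
    · simp only [hμ₀]
      rw [if_pos (by omega)]
      omega
    · rw [Finset.mem_union, Finset.mem_range, Finset.mem_Ico] at hi
      have e1 := hηκ (η 0 - t) i
      have e2 := hηκ 0 i
      simp only [hμ₀]
      split_ifs <;> omega
  · have := hηκ 0 2
    omega
  · have := hηL i
    simp only [hμ₀]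
    split_ifs <;> omega
  · rw [Finset.mem_union, Finset.mem_range, Finset.mem_Ico] at hi
    have e1 := hηκ (η 0 - t) i
    have e2 := hηκ 0 i
    simp only [hμ₀]
    split_ifs <;> omega

lemma hasGoodRows_or_conj {m a : ℕ} (hm : 5 ≤ m) (ha : 10 ≤ a) {l : ℕ → ℕ}
    (hl : l ∈ Bset (m + 3 * a) (m + (2 * a - 2))) :
    HasGoodRows m a l ∨ HasGoodRows m a (conj l) := by
  obtain ⟨hP, h0, h1⟩ := hl
  by_cases hlen : conj l 0 ≤ 2 * a - 2
  · exact Or.inl (hasGoodRows_of_short hm ha hP hlen h0)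
  by_cases hwid : l 0 ≤ 2 * a - 2
  · refine Or.inr (hasGoodRows_of_short hm ha ⟨hP.1.conj, by rw [psize_conj hP.1.2, hP.2]⟩ ?_ h1)
    rwa [conj_conj hP.1]
  by_cases hρ : 2 * a - 2 ≤ l (conj l 0 - (2 * a - 2))
  · exact Or.inl (hasGoodRows_of_wide ha hP (not_le.1 hwid) (not_le.1 hlen) hρ)
  · exact Or.inr (hasGoodRows_conj_of_narrow ha hP (not_le.1 hwid) (not_le.1 hlen) (not_le.1 hρ))

lemma psize_pair (x y : ℕ) : psize (ofList [x, y]) = x + y := by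
  rw [psize_eq_sum (M := 2)]
  · simp [Finset.sum_range_succ, ofList_pair]
  · intro i hi
    rw [ofList_pair, if_neg (by omega), if_neg (by omega)]

lemma psize_hookP (x b : ℕ) : psize (hookP x b) = x + b := by
  rw [psize_eq_sum (M := b + 1), Finset.sum_range_succ', Finset.sum_congr rfl (g := fun _ => 1)]
  · simp [hookP_apply, add_comm]
  · intro i hi
    rw [Finset.mem_range] at hi
    rw [hookP_apply, if_neg (by omega), if_pos (by omega)]
  · intro i hi
    rw [hookP_apply, if_neg (by omega), if_neg (by omega)]

lemma hookP_mem_typeFive {a : ℕ} (ha : 4 ≤ a) : hookP (2 * a) a ∈ typeFive a := by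
  have h0 : hookP (2 * a) a 0 = 2 * a := by simp [hookP_apply]
  have h1 : hookP (2 * a) a 1 = 1 := by
    rw [hookP_apply, if_neg one_ne_zero, if_pos (by omega)]
  refine mem_typeFive_of_head ha ⟨isPartition_hookP a (by omega), ?_⟩ (by omega) (by omega) ?_
  · rw [psize_hookP]
    ring
  · rintro (h | h | h | h)
    · rw [h] at h1
      simp [ofList] at h1
      omega
    · rw [h] at h1
      simp [ofList] at h1
    · rw [h, ofList_pair, if_pos rfl] at h0
      omega
    · rw [h, hookP_apply, if_pos rfl] at h0
      omega

lemma pair_mem_typeFive {a : ℕ} (ha : 4 ≤ a) : ofList [2 * a, a] ∈ typeFive a := by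
  refine mem_typeFive_of_head ha ⟨isPartition_pair (by omega), ?_⟩ (by simp [ofList])
    (by simp [ofList]) ?_
  · rw [psize_pair]
    ring
  · have h0 : ofList [2 * a, a] 0 = 2 * a := rfl
    have h1 : ofList [2 * a, a] 1 = a := rfl
    rintro (h | h | h | h)
    · rw [h] at h1
      simp [ofList] at h1
      omega
    · rw [h] at h1
      simp [ofList] at h1
      omega
    · rw [h, ofList_pair, if_pos rfl] at h0
      omega
    · rw [h, hookP_apply, if_pos rfl] at h0
      omega

lemma conj_row {m : ℕ} (hm : 1 ≤ m) : conj (consPart m fun _ => 0) = hookP 1 (m - 1) := by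
  refine conj_eq_of_iff (isPartition_row m) fun i j => ?_
  rw [consPart_apply, hookP_apply]
  split_ifs <;> omega

lemma conj_hookP {x b : ℕ} (hx : 1 ≤ x) : conj (hookP x b) = hookP (b + 1) (x - 1) := by
  refine conj_eq_of_iff (isPartition_hookP b hx) fun i j => ?_
  rw [hookP_apply, hookP_apply]
  split_ifs <;> omega

lemma hasGoodRows_conj_hook {m a : ℕ} (hm : 3 ≤ m) (ha : 4 ≤ a) :
    HasGoodRows m a (conj (hookP (m + 2 * a - 1) (a + 1))) := by
  refine ⟨_, conj_mem_typeOne (by omega) (row_mem_typeOne hm), ?_⟩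
  rw [conj_row (by omega), conj_hookP (by omega)]
  have hval : ∀ i, hookP (a + 1 + 1) (m + 2 * a - 1 - 1) i - hookP 1 (m - 1) i =
      if i = 0 then a + 1 else if m ≤ i ∧ i < m + 2 * a - 1 then 1 else 0 := by
    intro i
    rw [hookP_apply, hookP_apply]
    split_ifs <;> omega
  refine ⟨fun i => ?_, ?_⟩
  · rw [hookP_apply, hookP_apply]
    split_ifs <;> omega
  have hd : (conj fun i => hookP (a + 1 + 1) (m + 2 * a - 1 - 1) i - hookP 1 (m - 1) i) =
      hookP (2 * a) a := by
    funext c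
    have hfilter : ((Finset.range (m + 2 * a - 1)).filter fun i =>
        c < hookP (a + 1 + 1) (m + 2 * a - 1 - 1) i - hookP 1 (m - 1) i) =
        if c = 0 then insert 0 (Finset.Ico m (m + 2 * a - 1)) else if c ≤ a then {0} else ∅ := by
      ext i
      rw [Finset.mem_filter, hval, Finset.mem_range]
      split_ifs <;> simp <;> omega
    rw [conj_eq_card (M := m + 2 * a - 1), hfilter, hookP_apply]
    · split_ifs
      · rw [Finset.card_insert_of_notMem (by simp; omega), Nat.card_Ico]
        omega
      · simp
      · simp
    · intro i hi
      rw [hval, if_neg (by omega), if_neg (by omega)]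
  rw [hd]
  exact conj_mem_typeFive ha (hookP_mem_typeFive ha)

lemma pair_mem_star {m a : ℕ} (hm : 3 ≤ m) (ha : 4 ≤ a) :
    ofList [m + 2 * a - 1, a + 1] ∈ starOp (typeOne m) (typeFive a) := by
  have hl : IsPartition (ofList [m + 2 * a - 1, a + 1]) := isPartition_pair (by omega)
  have hmem : ∀ i j, (i, j) ∈ skewCells (ofList [m + 2 * a - 1, a + 1]) (consPart m fun _ => 0) ↔
      (i = 0 ∧ m ≤ j ∧ j < m + 2 * a - 1) ∨ (i = 1 ∧ j < a + 1) := by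
    intro i j
    simp only [skewCells, Set.mem_ofPred_eq, ofList_pair, consPart_apply]
    split_ifs <;> omega
  refine ⟨hl, _, row_mem_typeOne hm, _, pair_mem_typeFive ha, (LRcoeff_pos_iff hl).2 ⟨?_, ?_⟩⟩
  · intro i
    rw [ofList_pair, consPart_apply]
    split_ifs <;> omega
  refine ⟨fun c => if c.1 = 0 ∨ c.2 = 0 then 1 else 2, IsLRFilling.of_label
    (φ := fun c => if c.1 = 0 then c.2 else if c.2 = 0 then 0 else m + c.2 - 1)
    (skewCells_finite hl.2 _) ?_ ?_ ?_ ?_ ?_ ?_⟩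
  · intro c _
    split_ifs <;> omega
  · intro i j j' _ _ _
    simp only
    split_ifs <;> omega
  · intro i i' j h h' _
    rw [hmem] at h h'
    simp only
    split_ifs <;> omega
  · rintro ⟨i, j⟩ h ⟨i', j'⟩ h'
    rw [hmem] at h h'
    simp only [Prod.mk.injEq]
    intro hφ hT
    split_ifs at hφ hT <;> omega
  · rintro ⟨i, j⟩ h v hv
    rw [hmem] at h
    simp only
    intro hT
    split_ifs at hT with hij
    · omega
    · refine ⟨(0, m + j - 1), (hmem _ _).2 (by omega), ?_, ?_, Or.inl (by simp only; omega)⟩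
      · simp only [if_true]
        rw [if_neg (by omega), if_neg (by omega)]
      · simp only [true_or, if_true]
        omega
  · intro t
    have himage : (fun c : ℕ × ℕ => if c.1 = 0 then c.2 else if c.2 = 0 then 0 else m + c.2 - 1) ''
        {c ∈ skewCells (ofList [m + 2 * a - 1, a + 1]) (consPart m fun _ => 0) |
          (if c.1 = 0 ∨ c.2 = 0 then 1 else 2) = t + 1} =
        ((if t = 0 then insert 0 (Finset.Ico m (m + 2 * a - 1))
          else if t = 1 then Finset.Ico m (m + a) else ∅ : Finset ℕ) : Set ℕ) := by
      ext x
      constructor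
      · rintro ⟨⟨i, j⟩, ⟨h, hT⟩, rfl⟩
        rw [hmem] at h
        simp only at hT ⊢
        split_ifs at hT with hij
        · rw [if_pos (by omega : t = 0)]
          rw [Finset.mem_coe, Finset.mem_insert, Finset.mem_Ico]
          split_ifs <;> omega
        · rw [if_neg (by omega : t ≠ 0), if_pos (by omega : t = 1)]
          rw [Finset.mem_coe, Finset.mem_Ico, if_neg (by omega), if_neg (by omega)]
          omega
      · intro hx
        split_ifs at hx with h0 h1
        · rw [Finset.mem_coe, Finset.mem_insert, Finset.mem_Ico] at hx
          rcases hx with rfl | hx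
          · exact ⟨(1, 0), ⟨(hmem _ _).2 (by omega), by simp [h0]⟩, by simp⟩
          · exact ⟨(0, x), ⟨(hmem _ _).2 (by omega), by simp [h0]⟩, by simp⟩
        · rw [Finset.mem_coe, Finset.mem_Ico] at hx
          refine ⟨(1, x - m + 1), ⟨(hmem _ _).2 (by omega), by simp [h1]⟩, ?_⟩
          simp only [one_ne_zero, if_false, Nat.succ_ne_zero]
          omega
        · simp at hx
    rw [himage, Set.ncard_coe_finset, ofList_pair]
    split_ifs
    · rw [Finset.card_insert_of_notMem (by simp; omega), Nat.card_Ico]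
      omega
    · rw [Nat.card_Ico]
      omega
    · rfl

lemma conj_pair_mem_star {m a : ℕ} (hm : 3 ≤ m) (ha : 4 ≤ a) :
    conj (ofList [m + 2 * a - 1, a + 1]) ∈ starOp (typeOne m) (typeFive a) := by
  have hl : IsPartition (ofList [m + 2 * a - 1, a + 1]) := isPartition_pair (by omega)
  have hmem : ∀ i j, (i, j) ∈ skewCells (conj (ofList [m + 2 * a - 1, a + 1]))
      (conj (consPart m fun _ => 0)) ↔
      (j = 0 ∧ m ≤ i ∧ i < m + 2 * a - 1) ∨ (j = 1 ∧ i < a + 1) := by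
    intro i j
    simp only [skewCells, Set.mem_ofPred_eq]
    rw [lt_conj_iff hl, ← not_lt, lt_conj_iff (isPartition_row m), ofList_pair, consPart_apply]
    split_ifs <;> omega
  have hν : conj (ofList [2 * a, a]) = fun t => if t < a then 2 else if t < 2 * a then 1 else 0 := by
    refine conj_eq_of_iff (isPartition_pair (by omega)) fun i j => ?_
    rw [ofList_pair]
    split_ifs <;> omega
  refine ⟨hl.conj, _, conj_mem_typeOne (by omega) (row_mem_typeOne hm), _,
    conj_mem_typeFive ha (pair_mem_typeFive ha), (LRcoeff_pos_iff hl.conj).2 ⟨?_, ?_⟩⟩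
  · intro i
    refine le_of_not_gt fun hc => ?_
    have e1 := (lt_conj_iff (isPartition_row m) _ _).1 hc
    have e2 := lt_conj_iff hl (conj (ofList [m + 2 * a - 1, a + 1]) i) i
    rw [consPart_apply] at e1
    rw [ofList_pair] at e2
    split_ifs at e1 e2 <;> omega
  refine ⟨fun c => if c.2 = 1 then c.1 + 1 else if c.1 < m + a then c.1 - m + 1 else c.1 - m + 2,
    IsLRFilling.of_label (φ := fun c => if c.2 = 1 then 1 else if c.1 < m + a then 0 else 1)
    (skewCells_finite hl.conj.2 _) ?_ ?_ ?_ ?_ ?_ ?_⟩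
  · intro c _
    split_ifs <;> omega
  · intro i j j' h h' _
    rw [hmem] at h h'
    simp only
    split_ifs <;> omega
  · intro i i' j h h' _
    rw [hmem] at h h'
    simp only
    split_ifs <;> omega
  · rintro ⟨i, j⟩ h ⟨i', j'⟩ h'
    rw [hmem] at h h'
    simp only [Prod.mk.injEq]
    intro hφ hT
    split_ifs at hφ hT <;> omega
  · rintro ⟨i, j⟩ h v hv hT
    rw [hmem] at h
    simp only at hT
    by_cases hia : j = 0 ∧ i = m + a
    · refine ⟨(a, 1), (hmem _ _).2 (by omega), ?_, ?_, Or.inl (by simp only; omega)⟩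
      · simp only [if_true]
        split_ifs <;> omega
      · simp only [if_true]
        split_ifs at hT <;> omega
    · refine ⟨(i - 1, j), (hmem _ _).2 ?_, ?_, ?_, Or.inl ?_⟩
      · split_ifs at hT <;> omega
      · simp only
        split_ifs at hT ⊢ <;> omega
      · simp only
        split_ifs at hT ⊢ <;> omega
      · simp only
        split_ifs at hT <;> omega
  · intro t
    have himage : (fun c : ℕ × ℕ => if c.2 = 1 then 1 else if c.1 < m + a then 0 else 1) ''
        {c ∈ skewCells (conj (ofList [m + 2 * a - 1, a + 1])) (conj (consPart m fun _ => 0)) |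
          (if c.2 = 1 then c.1 + 1 else if c.1 < m + a then c.1 - m + 1 else c.1 - m + 2) =
            t + 1} =
        ((if t < a then {0, 1} else if t < 2 * a then {1} else ∅ : Finset ℕ) : Set ℕ) := by
      ext x
      constructor
      · rintro ⟨⟨i, j⟩, ⟨h, hT⟩, rfl⟩
        rw [hmem] at h
        simp only at hT ⊢
        split_ifs at hT ⊢ <;> simp <;> omega
      · intro hx
        by_cases hx1 : x = 1
        · by_cases hta : t < a + 1
          · exact ⟨(t, 1), ⟨(hmem _ _).2 (by omega), by simp⟩, by simp [hx1]⟩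
          · have ht2 : t < 2 * a := by
              by_contra hc
              rw [if_neg (by omega), if_neg hc] at hx
              simp at hx
            refine ⟨(m + t - 1, 0), ⟨(hmem _ _).2 (by omega), ?_⟩, ?_⟩
            · simp only [zero_ne_one, if_false]
              rw [if_neg (by omega)]
              omega
            · simp only [zero_ne_one, if_false]
              rw [if_neg (by omega), hx1]
        · have ht1 : t < a ∧ x = 0 := by
            split_ifs at hx with h1 h2
            · simp at hx
              omega
            · simp at hx
              omega
            · simp at hx
          refine ⟨(m + t, 0), ⟨(hmem _ _).2 (by omega), ?_⟩, ?_⟩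
          · simp only [zero_ne_one, if_false]
            rw [if_pos (by omega)]
            omega
          · simp only [zero_ne_one, if_false]
            rw [if_pos (by omega), ht1.2]
    rw [himage, Set.ncard_coe_finset, hν]
    simp only
    split_ifs <;> simp

lemma consPart_tail_mem_Pset {m a x : ℕ} {l : ℕ → ℕ} (hl : l ∈ Pset (m + 3 * a))
    (h0 : l 0 = m + x) (hx : 3 * a ≤ 2 * x) : (consPart x fun i => l (i + 1)) ∈ Pset (3 * a) := by
  have h1 := psize_tail hl.1
  have h2 := head_le_psize hl.1.tail
  have h3 := hl.2
  refine ⟨hl.1.tail.consPart (by omega), ?_⟩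
  rw [psize_consPart _ hl.1.tail.2]
  omega

lemma hasGoodRows_of_tail {m a x : ℕ} (hm : 3 ≤ m) (ha : 4 ≤ a) {l : ℕ → ℕ}
    (hl : l ∈ Pset (m + 3 * a)) (h0 : l 0 = m + x) (hx : 2 * a - 1 ≤ x) (hx' : x ≤ 2 * a)
    (h : (consPart x fun i => l (i + 1)) ∉ excluded a) : HasGoodRows m a l := by
  have hd := consPart_tail_mem_Pset hl h0 (by omega)
  refine hasGoodRows_of_row hm (by omega) ?_
  rw [h0, Nat.add_sub_cancel_left, conj_conj hd.1]
  exact mem_typeFive_of_head ha hd hx hx' h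

lemma isPartition_and_hasGoodRows_of_mem_longRows {m a : ℕ} (hm : 3 ≤ m) (ha : 4 ≤ a) {l : ℕ → ℕ} (hl : l ∈ longRows m a) :
    IsPartition l ∧ HasGoodRows m a l := by
  obtain ⟨β, ⟨⟨hβ, hs⟩, hne⟩, rfl⟩ := hl
  have h0 := head_le_psize hβ
  have hp : IsPartition (consPart (m + 2 * a) β) := hβ.consPart (by omega)
  refine ⟨hp, hasGoodRows_of_tail (x := 2 * a) hm ha ⟨hp, ?_⟩ rfl (by omega) le_rfl ?_⟩
  · rw [psize_consPart _ hβ.2]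
    omega
  · have htail : (fun i => consPart (m + 2 * a) β (i + 1)) = β := by
      funext i
      simp [consPart_apply]
    rw [htail]
    rintro (h | h | h | h)
    · rw [ofList_triple_eq] at h
      exact hne (Or.inl (consPart_inj h))
    · rw [ofList_cons_hook_eq] at h
      exact hne (Or.inr (consPart_inj h))
    · have := congrFun h 0
      simp only [consPart_apply, ofList_pair, if_true] at this
      omega
    · have := congrFun h 0
      simp only [consPart_apply, hookP_apply, if_true] at this
      omega

lemma mem_star_of_head {m a : ℕ} (hm : 3 ≤ m) (ha : 4 ≤ a) {l : ℕ → ℕ}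
    (hl : l ∈ Pset (m + 3 * a)) (h0 : l 0 = m + 2 * a - 1) :
    l ∈ starOp (typeOne m) (typeFive a) ∧ conj l ∈ starOp (typeOne m) (typeFive a) := by
  by_cases h : (consPart (2 * a - 1) fun i => l (i + 1)) ∈ excluded a
  · rcases h with h | h | h | h
    · have := congrFun h 0
      simp [consPart_apply, ofList] at this
      omega
    · have := congrFun h 0
      simp [consPart_apply, ofList] at this
      omega
    · have hl' : l = ofList [m + 2 * a - 1, a + 1] := by
        funext i
        rcases i with _ | i
        · simpa [ofList] using h0
        · simpa [consPart_apply, ofList] using congrFun h (i + 1)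
      rw [hl']
      exact ⟨pair_mem_star hm ha, conj_pair_mem_star hm ha⟩
    · have hl' : l = hookP (m + 2 * a - 1) (a + 1) := by
        funext i
        rcases i with _ | i
        · simpa [hookP_apply] using h0
        · simpa [consPart_apply, hookP_apply] using congrFun h (i + 1)
      have hgood := hasGoodRows_conj_hook hm ha
      rw [← hl'] at hgood
      have h1 := hgood.conj_mem_star (by omega) ha hl.1.conj
      rw [conj_conj hl.1] at h1
      exact ⟨h1, hgood.mem_star hl.1.conj⟩
  · have hgood := hasGoodRows_of_tail hm ha hl (by omega) le_rfl (by omega) h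
    exact ⟨hgood.mem_star hl.1, hgood.conj_mem_star (by omega) ha hl.1⟩

lemma mem_star_of_mem_rhs {m a : ℕ} (hm : 5 ≤ m) (ha : 10 ≤ a) {l : ℕ → ℕ}
    (hl : l ∈ Bset (m + 3 * a) (m + 2 * a - 1) ∪ conjClosure (longRows m a)) :
    l ∈ starOp (typeOne m) (typeFive a) := by
  rcases hl with hl | hl | ⟨l, hl, rfl⟩
  · obtain ⟨hP, h0, h1⟩ := id hl
    have hP' := (conj_mem_Bset hl).1
    by_cases h0' : l 0 = m + 2 * a - 1
    · exact (mem_star_of_head (by omega) (by omega) hP h0').1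
    by_cases h1' : conj l 0 = m + 2 * a - 1
    · have := (mem_star_of_head (by omega) (by omega) hP' h1').2
      rwa [conj_conj hP.1] at this
    rcases hasGoodRows_or_conj hm ha (l := l) ⟨hP, by omega, by omega⟩ with h | h
    · exact h.mem_star hP.1
    · have := h.conj_mem_star (by omega) (by omega) hP.1.conj
      rwa [conj_conj hP.1] at this
  · obtain ⟨hp, h⟩ := isPartition_and_hasGoodRows_of_mem_longRows (by omega) (by omega) hl
    exact h.mem_star hp
  · obtain ⟨hp, h⟩ := isPartition_and_hasGoodRows_of_mem_longRows (by omega) (by omega) hl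
    exact h.conj_mem_star (by omega) (by omega) hp

/-- for `k ≥ 3`, `h ≥ 4`, `a = 3^{h−1}`, `n = 3^k + 3^h`,
`N = 3^k + 2a`, one has
`(P(3^k) ∖ {(3^k−1, 1), (2, 1^{3^k−2})}) ⋆ C_h
  = B_n(N−1) ∪ {(N, μ) : μ ∈ P(a) ∖ {(a−1, 1), (2, 1^{a−2})}}°`. -/
theorem star_type1_type5 (k h : ℕ) (hk : 3 ≤ k) (hh : 4 ≤ h) :
    starOp (Pset (3 ^ k) \ {ofList [3 ^ k - 1, 1], hookP 2 (3 ^ k - 2)}) (Cset h) =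
      Bset (3 ^ k + 3 ^ h) (3 ^ k + 2 * 3 ^ (h - 1) - 1) ∪
        conjClosure
          (consPart (3 ^ k + 2 * 3 ^ (h - 1)) ''
            (Pset (3 ^ (h - 1)) \
              {ofList [3 ^ (h - 1) - 1, 1], hookP 2 (3 ^ (h - 1) - 2)})) := by

  have hm : 27 ≤ 3 ^ k := Nat.pow_le_pow_right (n := 3) (by norm_num) hk
  have ha : 27 ≤ 3 ^ (h - 1) := Nat.pow_le_pow_right (n := 3) (by norm_num) (by omega : 3 ≤ h - 1)
  have hpow : 3 ^ h = 3 * 3 ^ (h - 1) := by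
    rw [← pow_succ', Nat.sub_add_cancel (by omega)]
  have hC : Cset h = typeFive (3 ^ (h - 1)) := by
    unfold Cset
    rw [hpow]
    rfl
  rw [hC, hpow]
  exact Set.Subset.antisymm (fun l hl => star_subset (by omega) (by omega) hl)
    fun l hl => mem_star_of_mem_rhs (by omega) (by omega) hl

end SylowBranching
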